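/- For every integer t ≥ 5 there exists a constant C_t > 0 such that for every integer n ≥ 2, every finite simple graph with no K_t-minor that contains every n-vertex planar graph as a subgraph has at least 2^{C_t · n} vertices. -/

import Mathlib

open SimpleGraph

/-- `H` is a minor of `G`: there are pairwise disjoint, connected (hence nonempty) branch
sets, one for each vertex of `H`, with an edge of `G` between the branch sets of any two
adjacent vertices of `H`. -/
def SimpleGraph.HasMinor {α : Type*} {β : Type*} (G : SimpleGraph α) (H : SimpleGraph β) : Prop :=
  ∃ B : β → Set α,
    (∀ b, (SimpleGraph.induce (B b) G).Connected) ∧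
    (Pairwise fun b b' => Disjoint (B b) (B b')) ∧
    (∀ b b', H.Adj b b' → ∃ u ∈ B b, ∃ v ∈ B b', G.Adj u v)
/-- `U` contains `H` as a subgraph. -/
def ContainsSub {α β : Type*} (U : SimpleGraph β) (H : SimpleGraph α) : Prop :=
  ∃ f : α → β, Function.Injective f ∧ ∀ a b, H.Adj a b → U.Adj (f a) (f b)
/-- Planarity, via Wagner's theorem: no `K₅` minor and no `K₃,₃` minor. -/
def IsPlanarW {V : Type*} (G : SimpleGraph V) : Prop :=
  ¬ G.HasMinor (⊤ : SimpleGraph (Fin 5)) ∧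
  ¬ G.HasMinor (completeBipartiteGraph (Fin 3) (Fin 3))

/-- `u` and `v` are joined by a path of `G` all of whose vertices lie in `S`. -/
def ReachIn {V : Type*} (G : SimpleGraph V) (S : Set V) (u v : V) : Prop :=
  Relation.ReflTransGen (fun x y => G.Adj x y ∧ x ∈ S ∧ y ∈ S) u v

/-- `S` is nonempty and induces a connected subgraph of `G`. -/
def ConnIn {V : Type*} (G : SimpleGraph V) (S : Set V) : Prop :=
  S.Nonempty ∧ ∀ u ∈ S, ∀ v ∈ S, ReachIn G S u v

section Connectivity

variable {V : Type*} {G : SimpleGraph V} {S T : Set V} {u v w : V}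

lemma ReachIn.refl (u : V) : ReachIn G S u u := Relation.ReflTransGen.refl

lemma ReachIn.trans (h : ReachIn G S u v) (h' : ReachIn G S v w) : ReachIn G S u w :=
  Relation.ReflTransGen.trans h h'

lemma ReachIn.symm (h : ReachIn G S u v) : ReachIn G S v u := by
  induction h with
  | refl => exact ReachIn.refl _
  | tail _ h ih => exact Relation.ReflTransGen.head ⟨h.1.symm, h.2.2, h.2.1⟩ ih

lemma ReachIn.single (h : G.Adj u v) (hu : u ∈ S) (hv : v ∈ S) : ReachIn G S u v :=
  Relation.ReflTransGen.single ⟨h, hu, hv⟩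

lemma ReachIn.mono (hST : S ⊆ T) (h : ReachIn G S u v) : ReachIn G T u v := by
  induction h with
  | refl => exact ReachIn.refl _
  | tail _ h ih => exact ih.trans (ReachIn.single h.1 (hST h.2.1) (hST h.2.2))

lemma ReachIn.map {W : Type*} {G' : SimpleGraph W} {S' : Set W} {f : V → W}
    (hf : ∀ x ∈ S, ∀ y ∈ S, G.Adj x y → ReachIn G' S' (f x) (f y))
    (h : ReachIn G S u v) : ReachIn G' S' (f u) (f v) := by
  induction h with
  | refl => exact ReachIn.refl _
  | tail _ h ih => exact ih.trans (hf _ h.2.1 _ h.2.2 h.1)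

lemma ConnIn.of_base (hu : u ∈ S) (h : ∀ v ∈ S, ReachIn G S u v) : ConnIn G S :=
  ⟨⟨u, hu⟩, fun x hx y hy => (h x hx).symm.trans (h y hy)⟩

lemma connIn_iff_induce_connected : ConnIn G S ↔ (G.induce S).Connected := by
  constructor
  · rintro ⟨⟨x, hx⟩, h⟩
    rw [SimpleGraph.connected_iff_exists_forall_reachable]
    refine ⟨⟨x, hx⟩, ?_⟩
    rintro ⟨y, hy⟩
    have key : ∀ z, ReachIn G S x z → ∀ hz : z ∈ S,
        (G.induce S).Reachable ⟨x, hx⟩ ⟨z, hz⟩ := by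
      intro z hz
      induction hz with
      | refl => intro _; exact Reachable.refl _
      | tail _ h ih =>
        intro hz
        refine (ih h.2.1).trans (SimpleGraph.Adj.reachable ?_)
        exact h.1
    exact key y (h x hx y hy) hy
  · intro h
    obtain ⟨⟨x, hx⟩⟩ := h.nonempty
    refine ConnIn.of_base hx ?_
    intro y hy
    obtain ⟨p⟩ := h.preconnected ⟨x, hx⟩ ⟨y, hy⟩
    have key : ∀ (a b : S), (G.induce S).Walk a b → ReachIn G S (a : V) (b : V) := by
      intro a b p
      induction p with
      | nil => exact ReachIn.refl _
      | @cons a b _ h _ ih => exact (ReachIn.single (G := G) h a.2 b.2).trans ih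
    exact key _ _ p

lemma ConnIn.image {W : Type*} {G' : SimpleGraph W} {f : V → W} (h : ConnIn G S)
    (hf : ∀ x ∈ S, ∀ y ∈ S, G.Adj x y → G'.Adj (f x) (f y)) : ConnIn G' (f '' S) := by
  obtain ⟨⟨x, hx⟩, h⟩ := h
  refine ConnIn.of_base (Set.mem_image_of_mem f hx) ?_
  rintro _ ⟨y, hy, rfl⟩
  refine (h x hx y hy).map ?_
  intro a ha b hb hab
  exact ReachIn.single (hf a ha b hb hab) ⟨a, ha, rfl⟩ ⟨b, hb, rfl⟩

lemma ConnIn.insert_adj (h : ConnIn G S) (hu : u ∈ S) (huv : G.Adj u v) :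
    ConnIn G (insert v S) := by
  refine ConnIn.of_base (Set.mem_insert_of_mem v hu) ?_
  rintro x (rfl | hx)
  · exact ReachIn.single huv (Set.mem_insert_of_mem _ hu) (Set.mem_insert _ _)
  · exact (h.2 u hu x hx).mono (Set.subset_insert _ _)

lemma connIn_pair (h : G.Adj u v) : ConnIn G {u, v} := by
  refine ConnIn.of_base (Set.mem_insert u _) ?_
  rintro x (rfl | rfl)
  · exact ReachIn.refl _
  · exact ReachIn.single h (Set.mem_insert _ _) (Set.mem_insert_of_mem _ rfl)

/-- A `K_t` minor from branch sets that are connected in the sense of `ConnIn`. -/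
lemma hasMinor_top_of_connIn {t : ℕ} (B : Fin t → Set V) (hB : ∀ i, ConnIn G (B i))
    (hd : ∀ i j, i ≠ j → Disjoint (B i) (B j))
    (ha : ∀ i j, i ≠ j → ∃ u ∈ B i, ∃ v ∈ B j, G.Adj u v) :
    G.HasMinor (⊤ : SimpleGraph (Fin t)) :=
  ⟨B, fun i => connIn_iff_induce_connected.1 (hB i), fun i j h => hd i j h,
    fun i j h => ha i j (by simpa using h)⟩

end Connectivity

/-- A combinatorial plane drawing of a locally finite graph: every edge `e` has endpoints `s e`,
`d e` and lies between the faces `l e`, `r e`. Around each vertex the faces close up, and every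
edge is homologous to a sum of rays `ray (s e)`, `ray (d e)` leaving its endpoints. -/
structure PlaneDrawing (V E F : Type*) [DecidableEq V] [DecidableEq E] where
  s : E → V
  d : E → V
  l : E → F
  r : E → F
  star : V → Finset E
  ray : V → E → ZMod 2
  s_ne_d : ∀ e, s e ≠ d e
  mem_star : ∀ p e, e ∈ star p ↔ s e = p ∨ d e = p
  sum_star : ∀ (κ : F → ZMod 2) (p : V), ∑ e ∈ star p, (κ (l e) + κ (r e)) = 0
  exists_side : ∀ e₀, ∃ q : F → ZMod 2, ∀ e,
    q (l e) + q (r e) = (if e = e₀ then 1 else 0) + ray (s e₀) e + ray (d e₀) e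

namespace PlaneDrawing

variable {V E F : Type*} [DecidableEq V] [DecidableEq E] (P : PlaneDrawing V E F)

/-- The graph drawn by `P`. -/
def graph : SimpleGraph V where
  Adj p q := ∃ e, (P.s e = p ∧ P.d e = q) ∨ (P.s e = q ∧ P.d e = p)
  symm := ⟨fun _ _ ⟨e, he⟩ => ⟨e, he.symm⟩⟩
  loopless := ⟨fun p ⟨e, he⟩ => P.s_ne_d e (by rcases he with h | h <;> rw [h.1, h.2])⟩

/-- Inside a connected branch set, two rays differ by a coboundary away from the contracted
edges. -/
lemma exists_side_of_reachIn (S : Set V) {u v : V} (h : ReachIn P.graph S u v) :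
    ∃ q : F → ZMod 2, ∀ e, ¬ (P.s e ∈ S ∧ P.d e ∈ S) →
      q (P.l e) + q (P.r e) = P.ray u e + P.ray v e := by
  induction h with
  | refl => exact ⟨0, fun e _ => by simp [CharTwo.add_self_eq_zero]⟩
  | @tail v w _ h ih =>
    obtain ⟨q, hq⟩ := ih
    obtain ⟨⟨e₀, he₀⟩, hv, hw⟩ := h
    obtain ⟨q', hq'⟩ := P.exists_side e₀
    refine ⟨q + q', fun e he => ?_⟩
    have hne : e ≠ e₀ := by
      rintro rfl
      rcases he₀ with h | h <;> exact he (by rw [h.1, h.2]; exact ⟨‹_›, ‹_›⟩)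
    have h1 := hq e he
    have h2 := hq' e
    have h3 : P.ray (P.s e₀) e + P.ray (P.d e₀) e = P.ray v e + P.ray w e := by
      rcases he₀ with h | h <;> rw [h.1, h.2]
      exact add_comm _ _
    have h4 := CharTwo.add_self_eq_zero (P.ray v e)
    simp only [hne, if_false, Pi.add_apply] at h2 ⊢
    linear_combination h1 + h2 + h3 + h4

variable {β ι : Type*}

/-- Each edge `edge i` of a minor model is homologous, away from the contracted edges, to the sum
of the rays at the base points of the two branch sets it joins. -/
lemma exists_side_of_model (B : β → Finset V) (hB : ∀ b, ConnIn P.graph (B b : Set V))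
    (c : β → V) (hc : ∀ b, c b ∈ B b) (b b' : β) (e₀ : E)
    (he₀ : (P.s e₀ ∈ B b ∧ P.d e₀ ∈ B b') ∨ (P.s e₀ ∈ B b' ∧ P.d e₀ ∈ B b)) :
    ∃ q : F → ZMod 2, ∀ e, (∀ b, ¬ (P.s e ∈ B b ∧ P.d e ∈ B b)) →
      q (P.l e) + q (P.r e) = (if e = e₀ then 1 else 0) + P.ray (c b) e + P.ray (c b') e := by
  wlog h : P.s e₀ ∈ B b ∧ P.d e₀ ∈ B b' generalizing b b'
  · obtain ⟨q, hq⟩ := this b' b he₀.symm (he₀.resolve_left h)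
    exact ⟨q, fun e he => by rw [hq e he]; ring⟩
  obtain ⟨q₁, h₁⟩ := P.exists_side e₀
  obtain ⟨q₂, h₂⟩ := P.exists_side_of_reachIn _ ((hB b).2 _ h.1 _ (hc b))
  obtain ⟨q₃, h₃⟩ := P.exists_side_of_reachIn _ ((hB b').2 _ h.2 _ (hc b'))
  refine ⟨q₁ + q₂ + q₃, fun e he => ?_⟩
  have h1 := h₁ e
  have h2 := h₂ e (he b)
  have h3 := h₃ e (he b')
  have h4 := CharTwo.add_self_eq_zero (P.ray (P.s e₀) e)
  have h5 := CharTwo.add_self_eq_zero (P.ray (P.d e₀) e)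
  simp only [Pi.add_apply]
  linear_combination h1 + h2 + h3 + h4 + h5

/-- Summing the closing-up condition over a finite vertex set `S`. -/
lemma sum_boundary (κ : F → ZMod 2) (S : Finset V) (U : Finset E)
    (hU : ∀ e, P.s e ∈ S ∨ P.d e ∈ S → e ∈ U) :
    ∑ e ∈ U, ((if P.s e ∈ S then 1 else 0) + (if P.d e ∈ S then 1 else 0)) *
      (κ (P.l e) + κ (P.r e)) = 0 := by
  have h1 : ∑ p ∈ S, ∑ e ∈ P.star p, (κ (P.l e) + κ (P.r e)) = 0 :=
    Finset.sum_eq_zero fun p _ => P.sum_star κ p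
  refine Eq.trans ?_ h1
  have h2 : ∀ p ∈ S, ∑ e ∈ P.star p, (κ (P.l e) + κ (P.r e)) =
      ∑ e ∈ U, ((if P.s e = p then 1 else 0) + (if P.d e = p then 1 else 0)) *
        (κ (P.l e) + κ (P.r e)) := by
    intro p hp
    have : P.star p = U.filter (fun e => P.s e = p ∨ P.d e = p) := by
      ext e
      rw [P.mem_star, Finset.mem_filter]
      refine ⟨fun h => ⟨hU e ?_, h⟩, fun h => h.2⟩
      rcases h with h | h <;> simp [h, hp]
    rw [this, Finset.sum_filter]
    refine Finset.sum_congr rfl fun e _ => ?_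
    have := P.s_ne_d e
    by_cases h : P.s e = p
    · have h' : P.d e ≠ p := fun h' => this (h.trans h'.symm)
      simp [h, h']
    · by_cases h' : P.d e = p <;> simp [h, h']
  rw [Finset.sum_congr rfl h2, Finset.sum_comm]
  refine Finset.sum_congr rfl fun e _ => ?_
  rw [← Finset.sum_mul, Finset.sum_add_distrib]
  simp

/-- A minor model in a plane drawing assigns vectors `L i`, `L i + (column i of c)` to the two sides
of each model edge so that, for every vector `a`, the model edges touching `a` form an even
subgraph. Here the rows of `c` are cycles of the model graph. -/
theorem exists_labels [DecidableEq β] [Fintype ι] [DecidableEq ι] {M : Type*} [Fintype M] (B : β → Finset V)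
    (hB : ∀ b, ConnIn P.graph (B b : Set V))
    (hd : ∀ b b', b ≠ b' → Disjoint (B b) (B b')) (s d : ι → β) (hsd : ∀ i, s i ≠ d i)
    (hinj : ∀ i j, (s i = s j ∧ d i = d j) ∨ (s i = d j ∧ d i = s j) → i = j)
    (hadj : ∀ i, ∃ u ∈ B (s i), ∃ v ∈ B (d i), P.graph.Adj u v)
    (c : M → ι → ZMod 2)
    (hc : ∀ m b, ∑ i, c m i * ((if s i = b then 1 else 0) + (if d i = b then 1 else 0)) = 0) :
    ∃ L : ι → M → ZMod 2, ∀ a b,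
      ∑ i, ((if s i = b then 1 else 0) + (if d i = b then 1 else 0)) *
        ((if L i = a then 1 else 0) + (if L i + (fun m => c m i) = a then 1 else 0)) =
          (0 : ZMod 2) := by
  have hadj' : ∀ i, ∃ e, (P.s e ∈ B (s i) ∧ P.d e ∈ B (d i)) ∨
      (P.s e ∈ B (d i) ∧ P.d e ∈ B (s i)) := by
    intro i
    obtain ⟨u, hu, v, hv, e, ⟨rfl, rfl⟩ | ⟨rfl, rfl⟩⟩ := hadj i
    · exact ⟨e, .inl ⟨hu, hv⟩⟩
    · exact ⟨e, .inr ⟨hv, hu⟩⟩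
  choose edge hedge using hadj'
  have huniq : ∀ {p b b'}, p ∈ B b → p ∈ B b' → b = b' := by
    intro p b b' h h'
    by_contra hne
    exact Finset.disjoint_left.1 (hd b b' hne) h h'
  have hedge_inj : Function.Injective edge := by
    intro i j hij
    apply hinj
    have h1 := hedge i
    have h2 := hedge j
    rw [hij] at h1
    rcases h1 with h1 | h1 <;> rcases h2 with h2 | h2
    · exact .inl ⟨huniq h1.1 h2.1, huniq h1.2 h2.2⟩
    · exact .inr ⟨huniq h1.1 h2.1, huniq h1.2 h2.2⟩
    · exact .inr ⟨huniq h1.2 h2.2, huniq h1.1 h2.1⟩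
    · exact .inl ⟨huniq h1.2 h2.2, huniq h1.1 h2.1⟩
  have hbase : ∀ b, ∃ p, p ∈ B b := fun b => (hB b).1
  choose c₀ hc₀ using hbase
  choose q hq using fun i => P.exists_side_of_model B hB c₀ hc₀ (s i) (d i) (edge i) (hedge i)
  set g : F → M → ZMod 2 := fun φ m => ∑ i, c m i * q i φ with hg
  have hg' : ∀ e, (∀ b, ¬ (P.s e ∈ B b ∧ P.d e ∈ B b)) → ∀ m,
      g (P.l e) m + g (P.r e) m = ∑ i, c m i * (if e = edge i then 1 else 0) := by
    intro e he m
    have h0 : ∑ i, c m i * (P.ray (c₀ (s i)) e + P.ray (c₀ (d i)) e) = 0 := by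
      classical
      have : ∀ i, c m i * (P.ray (c₀ (s i)) e + P.ray (c₀ (d i)) e) =
          ∑ b ∈ Finset.univ.image s ∪ Finset.univ.image d,
            (c m i * ((if s i = b then 1 else 0) + (if d i = b then 1 else 0))) *
              P.ray (c₀ b) e := by
        intro i
        simp only [mul_add, add_mul, Finset.sum_add_distrib]
        congr 1 <;> simp
      rw [Finset.sum_congr rfl fun i _ => this i, Finset.sum_comm]
      refine Finset.sum_eq_zero fun b _ => ?_
      rw [← Finset.sum_mul, hc, zero_mul]
    simp only [hg]
    rw [← Finset.sum_add_distrib]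
    rw [← sub_eq_zero, ← Finset.sum_sub_distrib]
    refine Eq.trans ?_ h0
    refine Finset.sum_congr rfl fun i _ => ?_
    linear_combination c m i * hq i e he
  refine ⟨fun i => g (P.l (edge i)), fun a b => ?_⟩
  have hR : ∀ i, g (P.l (edge i)) + (fun m => c m i) = g (P.r (edge i)) := by
    intro i
    funext m
    have hnc : ∀ b, ¬ (P.s (edge i) ∈ B b ∧ P.d (edge i) ∈ B b) := by
      rintro b ⟨h1, h2⟩
      rcases hedge i with h | h
      · exact hsd i ((huniq h.1 h1).trans (huniq h2 h.2))
      · exact hsd i ((huniq h.2 h2).trans (huniq h1 h.1))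
    have h1 := hg' (edge i) hnc m
    have h2 : ∑ j, c m j * (if edge i = edge j then 1 else 0) = c m i := by
      simp [hedge_inj.eq_iff]
    rw [h2] at h1
    have h3 := CharTwo.add_self_eq_zero (g (P.l (edge i)) m)
    simp only [Pi.add_apply]
    linear_combination h3 - h1
  simp only [hR]
  set κ : F → ZMod 2 := fun φ => if g φ = a then 1 else 0 with hκ
  set U : Finset E := (B b).biUnion P.star ∪ Finset.univ.image edge with hU
  have hsum := P.sum_boundary κ (B b) U (by
    rintro e (h | h)
    · exact Finset.mem_union_left _ (Finset.mem_biUnion.2 ⟨_, h, (P.mem_star _ _).2 (.inl rfl)⟩)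
    · exact Finset.mem_union_left _ (Finset.mem_biUnion.2 ⟨_, h, (P.mem_star _ _).2 (.inr rfl)⟩))
  rw [← Finset.sum_subset (Finset.subset_union_right : Finset.univ.image edge ⊆ U),
    Finset.sum_image (fun i _ j _ h => hedge_inj h)] at hsum
  · refine Eq.trans ?_ hsum
    refine Finset.sum_congr rfl fun i _ => ?_
    have hmem : ∀ {p b'}, p ∈ B b' → (p ∈ B b ↔ b' = b) := fun h =>
      ⟨fun h' => huniq h h', fun h' => h' ▸ h⟩
    congr 1
    rcases hedge i with h | h
    · simp only [hmem h.1, hmem h.2]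
    · simp only [hmem h.1, hmem h.2]
      exact add_comm _ _
  · intro e _ he
    have he' : ∀ i, e ≠ edge i := fun i h => he (h ▸ Finset.mem_image_of_mem _ (Finset.mem_univ i))
    by_cases hnc : ∃ b, P.s e ∈ B b ∧ P.d e ∈ B b
    · obtain ⟨b', h1, h2⟩ := hnc
      by_cases hb : b' = b
      · subst hb
        simp [h1, h2, CharTwo.add_self_eq_zero]
      · have h3 : P.s e ∉ B b := fun h => hb (huniq h1 h)
        have h4 : P.d e ∉ B b := fun h => hb (huniq h2 h)
        simp [h3, h4]
    · push Not at hnc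
      have : g (P.l e) = g (P.r e) := by
        funext m
        have := hg' e (fun b h => hnc b h.1 h.2) m
        simp only [he', if_false, mul_zero, Finset.sum_const_zero] at this
        exact CharTwo.add_eq_zero.1 this
      simp [hκ, this, CharTwo.add_self_eq_zero]

end PlaneDrawing

/-- If `A` contains both `L i` and `L i + col i` and every unit vector is a column, then `A` has
more elements than the dimension. -/
lemma card_lt_of_unit_differences {ι M : Type*} [Fintype M] [DecidableEq M] (L col : ι → M → ZMod 2)
    (hcol : ∀ m, ∃ i, col i = Pi.single m 1) (A : Finset (M → ZMod 2)) (hA : A.Nonempty)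
    (h₁ : ∀ i, L i ∈ A) (h₂ : ∀ i, L i + col i ∈ A) : Fintype.card M < A.card := by
  classical
  obtain ⟨a₀, ha₀⟩ := hA
  set W := Submodule.span (ZMod 2) (((A.erase a₀).image (fun a => a - a₀) : Finset _) :
    Set (M → ZMod 2)) with hW
  have hmem : ∀ a ∈ A, a - a₀ ∈ W := by
    intro a ha
    by_cases h : a = a₀
    · simp [h]
    · exact Submodule.subset_span (Finset.mem_coe.2
        (Finset.mem_image_of_mem _ (Finset.mem_erase.2 ⟨h, ha⟩)))
  have htop : W = ⊤ := by
    rw [eq_top_iff, ← (Pi.basisFun (ZMod 2) M).span_eq, Submodule.span_le]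
    rintro _ ⟨m, rfl⟩
    obtain ⟨i, hi⟩ := hcol m
    have := W.sub_mem (hmem _ (h₂ i)) (hmem _ (h₁ i))
    rw [show L i + col i - a₀ - (L i - a₀) = col i by abel, hi] at this
    simpa using this
  have h1 : Module.finrank (ZMod 2) W ≤ (A.erase a₀).card :=
    (finrank_span_finset_le_card _).trans Finset.card_image_le
  rw [htop, finrank_top, Module.finrank_fintype_fun_eq_card, Finset.card_erase_of_mem ha₀] at h1
  have : 0 < A.card := Finset.card_pos.2 ⟨_, ha₀⟩
  omega

/-- If every nonempty even edge set has at least `k` elements and the cycle space is large, the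
labels of `PlaneDrawing.exists_labels` cannot exist. -/
lemma no_labels {ι M β : Type*} [Fintype ι] [DecidableEq ι] [Fintype M] [DecidableEq M]
    [DecidableEq β] [Nonempty ι] (s d : ι → β) (c : M → ι → ZMod 2) (k : ℕ)
    (hunit : ∀ m, ∃ i, (fun m' => c m' i) = Pi.single m 1)
    (hne : ∀ i, ∃ m, c m i ≠ 0)
    (hk : ∀ T : Finset ι, T.Nonempty →
      (∀ b, ∑ i ∈ T, ((if s i = b then 1 else 0) + (if d i = b then 1 else 0)) = (0 : ZMod 2)) →
        k ≤ T.card)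
    (hcount : 2 * Fintype.card ι < k * (Fintype.card M + 1))
    (L : ι → M → ZMod 2)
    (hL : ∀ a b, ∑ i, ((if s i = b then 1 else 0) + (if d i = b then 1 else 0)) *
        ((if L i = a then 1 else 0) + (if L i + (fun m => c m i) = a then 1 else 0)) =
          (0 : ZMod 2)) : False := by
  classical
  set R : ι → M → ZMod 2 := fun i => L i + (fun m => c m i) with hR
  have hLR : ∀ i, L i ≠ R i := by
    intro i h
    obtain ⟨m, hm⟩ := hne i
    have := congrFun h m
    simp [hR] at this
    exact hm this
  set A := Finset.univ.image L ∪ Finset.univ.image R with hA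
  have hLA : ∀ i, L i ∈ A := fun i =>
    Finset.mem_union_left _ (Finset.mem_image_of_mem _ (Finset.mem_univ i))
  have hRA : ∀ i, R i ∈ A := fun i =>
    Finset.mem_union_right _ (Finset.mem_image_of_mem _ (Finset.mem_univ i))
  have hlt := card_lt_of_unit_differences L (fun i m => c m i) hunit A
    ⟨_, hLA (Classical.arbitrary ι)⟩ hLA hRA
  set T : (M → ZMod 2) → Finset ι := fun a => Finset.univ.filter (fun i => L i = a ∨ R i = a)
    with hT
  have hTk : ∀ a ∈ A, k ≤ (T a).card := by
    intro a ha
    apply hk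
    · rcases Finset.mem_union.1 ha with h | h <;> obtain ⟨i, -, rfl⟩ := Finset.mem_image.1 h
      · exact ⟨i, by simp [hT]⟩
      · exact ⟨i, by simp [hT]⟩
    · intro b
      rw [Finset.sum_filter]
      refine Eq.trans (Finset.sum_congr rfl fun i _ => ?_) (hL a b)
      have := hLR i
      change _ = _ * ((if L i = a then 1 else 0) + (if R i = a then 1 else 0))
      by_cases h1 : L i = a
      · have h2 : R i ≠ a := fun h2 => this (h1.trans h2.symm)
        simp [h1, h2]
      · by_cases h2 : R i = a <;> simp [h1, h2]
  have hsum : ∑ a ∈ A, (T a).card = 2 * Fintype.card ι := by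
    have h1 : ∀ a, (T a).card = ∑ i, ((if L i = a then 1 else 0) + (if R i = a then 1 else 0)) := by
      intro a
      rw [Finset.card_filter]
      refine Finset.sum_congr rfl fun i _ => ?_
      have := hLR i
      by_cases h1 : L i = a
      · have h2 : R i ≠ a := fun h2 => this (h1.trans h2.symm)
        simp [h1, h2]
      · by_cases h2 : R i = a <;> simp [h1, h2]
    simp only [h1]
    rw [Finset.sum_comm]
    simp only [Finset.sum_add_distrib, Finset.sum_ite_eq, hLA, hRA, if_true]
    simp
    ring
  have h3 : A.card * k ≤ ∑ a ∈ A, (T a).card := by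
    simpa using Finset.card_nsmul_le_sum A _ k hTk
  rw [hsum] at h3
  have : k * (Fintype.card M + 1) ≤ A.card * k := by
    rw [mul_comm]
    exact Nat.mul_le_mul_right _ hlt
  omega

namespace PlaneDrawing

variable {V E F : Type*} [DecidableEq V] [DecidableEq E] (P : PlaneDrawing V E F)

theorem no_K5_model (B : Fin 5 → Finset V) (hB : ∀ b, ConnIn P.graph (B b : Set V))
    (hd : ∀ b b', b ≠ b' → Disjoint (B b) (B b'))
    (hadj : ∀ b b', b ≠ b' → ∃ u ∈ B b, ∃ v ∈ B b', P.graph.Adj u v) : False := by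
  let ι := {p : Fin 5 × Fin 5 // p.1 < p.2}
  let M := {p : Fin 5 × Fin 5 // 0 < p.1 ∧ p.1 < p.2}
  let c : M → ι → ZMod 2 := fun m i =>
    if i.1 = m.1 ∨ (i.1.1 = 0 ∧ (i.1.2 = m.1.1 ∨ i.1.2 = m.1.2)) then 1 else 0
  obtain ⟨L, hL⟩ := P.exists_labels B hB hd (fun i : ι => i.1.1) (fun i => i.1.2)
    (fun i => i.2.ne) (by decide) (fun i => hadj _ _ i.2.ne) c (by decide)
  have : Nonempty ι := ⟨⟨(0, 1), by decide⟩⟩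
  refine no_labels _ _ c 3 ?_ (by decide) ?_ (by decide) L hL
  · intro m
    refine ⟨⟨m.1, m.2.2⟩, ?_⟩
    revert m
    decide
  · intro T hT hb
    by_contra hlt
    have h0 := hT.card_pos
    rcases (by omega : T.card = 1 ∨ T.card = 2) with h | h
    · obtain ⟨i, rfl⟩ := Finset.card_eq_one.1 h
      simp only [Finset.sum_singleton] at hb
      revert hb
      revert i
      decide
    · obtain ⟨i, j, hij, rfl⟩ := Finset.card_eq_two.1 h
      simp only [Finset.sum_pair hij] at hb
      revert hb hij
      clear h0 h hlt hT
      revert i j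
      decide

theorem no_K33_model (B : Fin 3 ⊕ Fin 3 → Finset V) (hB : ∀ b, ConnIn P.graph (B b : Set V))
    (hd : ∀ b b', b ≠ b' → Disjoint (B b) (B b'))
    (hadj : ∀ i j, ∃ u ∈ B (.inl i), ∃ v ∈ B (.inr j), P.graph.Adj u v) : False := by
  let c : Fin 2 × Fin 2 → Fin 3 × Fin 3 → ZMod 2 := fun m i =>
    if (i.1 = 0 ∨ i.1 = m.1.succ) ∧ (i.2 = 0 ∨ i.2 = m.2.succ) then 1 else 0
  obtain ⟨L, hL⟩ := P.exists_labels B hB hd (fun i : Fin 3 × Fin 3 => Sum.inl i.1)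
    (fun i => Sum.inr i.2) (by simp) (by decide) (fun i => hadj _ _) c (by decide)
  refine no_labels _ _ c 4 ?_ (by decide) ?_ (by decide) L hL
  · intro m
    refine ⟨(m.1.succ, m.2.succ), ?_⟩
    revert m
    decide
  · intro T hT hb
    by_contra hlt
    have h0 := hT.card_pos
    rcases (by omega : T.card = 1 ∨ T.card = 2 ∨ T.card = 3) with h | h | h
    · obtain ⟨i, rfl⟩ := Finset.card_eq_one.1 h
      simp only [Finset.sum_singleton] at hb
      revert hb
      revert i
      decide
    · obtain ⟨i, j, hij, rfl⟩ := Finset.card_eq_two.1 h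
      simp only [Finset.sum_pair hij] at hb
      revert hb hij
      clear h0 h hlt hT
      revert i j
      decide
    · obtain ⟨i, j, l, hij, hil, hjl, rfl⟩ := Finset.card_eq_three.1 h
      have hb' : ∀ b : Fin 3 ⊕ Fin 3, _ = (0 : ZMod 2) := fun b => by
        simpa only [Finset.sum_insert (show i ∉ ({j, l} : Finset _) by simp [hij, hil]),
          Finset.sum_pair hjl] using hb b
      clear h0 h hlt hT hb
      revert hb' hij hil hjl
      revert i j l
      decide

end PlaneDrawing

/-- The square grid on `ℤ × ℤ` with one diagonal in every unit cell: the cell with lower left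
corner `(x, y)` contains the ascending diagonal if `D x y = true` and the descending one
otherwise. -/
def triGrid (D : ℤ → ℤ → Bool) : SimpleGraph (ℤ × ℤ) :=
  SimpleGraph.fromRel fun p q =>
    (q.1 = p.1 + 1 ∧ q.2 = p.2) ∨ (q.1 = p.1 ∧ q.2 = p.2 + 1) ∨
    (q.1 = p.1 + 1 ∧ q.2 = p.2 + 1 ∧ D p.1 p.2 = true) ∨
    (q.1 = p.1 + 1 ∧ p.2 = q.2 + 1 ∧ D p.1 q.2 = false)

/-- The three edges attached to a lattice point: the one to its right, the one above it, and the
diagonal of the cell to its upper right. -/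
inductive EdgeKind
  | hor
  | ver
  | diag

instance : DecidableEq EdgeKind := fun a b => by
  cases a <;> cases b <;> first | exact isTrue rfl | exact isFalse (by simp)

/-- The left (or lower) endpoint of an edge of `triGrid D`. -/
def triGridSrc (D : ℤ → ℤ → Bool) : ℤ × ℤ × EdgeKind → ℤ × ℤ
  | (x, y, .diag) => (x, if D x y then y else y + 1)
  | (x, y, _) => (x, y)

/-- The right (or upper) endpoint of an edge of `triGrid D`. -/
def triGridDst (D : ℤ → ℤ → Bool) : ℤ × ℤ × EdgeKind → ℤ × ℤ
  | (x, y, .hor) => (x + 1, y)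
  | (x, y, .ver) => (x, y + 1)
  | (x, y, .diag) => (x + 1, if D x y then y + 1 else y)

/-- The standard plane drawing of `triGrid D`. Each cell consists of a left triangle (`false`) and
a right triangle (`true`); rays go to the right. -/
def triGridDrawing (D : ℤ → ℤ → Bool) :
    PlaneDrawing (ℤ × ℤ) (ℤ × ℤ × EdgeKind) (ℤ × ℤ × Bool) where
  s := triGridSrc D
  d := triGridDst D
  l
    | (x, y, .hor) => (x, y - 1, !D x (y - 1))
    | (x, y, .ver) => (x - 1, y, true)
    | (x, y, .diag) => (x, y, false)
  r
    | (x, y, .hor) => (x, y, D x y)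
    | (x, y, .ver) => (x, y, false)
    | (x, y, .diag) => (x, y, true)
  star p :=
    ({(p.1, p.2, .hor), (p.1 - 1, p.2, .hor), (p.1, p.2, .ver), (p.1, p.2 - 1, .ver),
      (p.1, p.2, .diag), (p.1 - 1, p.2, .diag), (p.1, p.2 - 1, .diag),
      (p.1 - 1, p.2 - 1, .diag)} : Finset (ℤ × ℤ × EdgeKind)).filter
      fun e => triGridSrc D e = p ∨ triGridDst D e = p
  ray
    | (i, j), (x, y, .hor) => if y = j ∧ i ≤ x then 1 else 0
    | _, _ => 0
  s_ne_d := by rintro ⟨x, y, _ | _ | _⟩ <;> simp [triGridSrc, triGridDst]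
  mem_star := by
    rintro ⟨i, j⟩ ⟨x, y, k⟩
    rw [Finset.mem_filter, and_iff_right_iff_imp]
    rcases k with _ | _ | _ <;>
    simp only [triGridSrc, triGridDst, Finset.mem_insert, Finset.mem_singleton, Prod.mk.injEq] <;>
    (try split_ifs) <;> simp <;> omega
  sum_star := by
    rintro κ ⟨x, y⟩
    rw [Finset.sum_filter]
    have h2 : (2 : ZMod 2) = 0 := rfl
    have e1 : ∀ a : ℤ, a - 1 ≠ a := fun a => by omega
    have e2 : ∀ a : ℤ, a ≠ a - 1 := fun a => by omega
    have e3 : ∀ a : ℤ, a + 1 ≠ a - 1 := fun a => by omega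
    simp only [Finset.sum_insert, Finset.sum_singleton, Finset.mem_insert, Finset.mem_singleton,
      Prod.mk.injEq, reduceCtorEq, and_false, and_true, or_false, false_or, e1, e2, not_false_eq_true,
      false_and, triGridSrc, triGridDst, true_and, sub_add_cancel, if_true, or_true, true_or]
    rcases h1 : D x y <;> rcases h3 : D (x - 1) y <;> rcases h4 : D x (y - 1) <;>
      rcases h5 : D (x - 1) (y - 1) <;> simp <;> ring_nf <;> simp [h2]
  exists_side := by
    rintro ⟨i, j, _ | _ | _⟩
    · refine ⟨0, ?_⟩
      rintro ⟨x, y, _ | _ | _⟩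
      · simp [triGridSrc, triGridDst]
        grind
      · simp
      · simp
    · refine ⟨fun φ => if φ.2.1 = j ∧ i ≤ φ.1 then 1 else 0, ?_⟩
      rintro ⟨x, y, _ | _ | _⟩
      · simp [triGridSrc, triGridDst]
        grind
      · simp
        grind
      · simp [CharTwo.add_self_eq_zero]
    · refine ⟨fun φ => if φ.2.1 = j ∧ (i < φ.1 ∨ i = φ.1 ∧ φ.2.2 = true) then 1 else 0, ?_⟩
      rintro ⟨x, y, _ | _ | _⟩
      · simp [triGridSrc, triGridDst]
        grind
      · simp
        grind
      · simp
        grind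

lemma triGridDrawing_graph (D : ℤ → ℤ → Bool) : (triGridDrawing D).graph = triGrid D := by
  ext ⟨a, b⟩ ⟨x, y⟩
  simp only [triGrid, SimpleGraph.fromRel_adj]
  constructor
  · rintro ⟨⟨i, j, _ | _ | _⟩, h⟩ <;> simp only [triGridDrawing, triGridSrc, triGridDst,
      Prod.mk.injEq] at h <;> obtain ⟨⟨rfl, rfl⟩, rfl, rfl⟩ | ⟨⟨rfl, rfl⟩, rfl, rfl⟩ := h <;>
      simp <;> grind
  · rintro ⟨-, h⟩
    wlog h' : (x = a + 1 ∧ y = b) ∨ (x = a ∧ y = b + 1) ∨ (x = a + 1 ∧ y = b + 1 ∧ D a b = true) ∨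
      (x = a + 1 ∧ b = y + 1 ∧ D a y = false) generalizing a b x y
    · exact ((triGridDrawing D).graph.adj_comm _ _).1 (this x y a b h.symm (h.resolve_left h'))
    rcases h' with ⟨rfl, rfl⟩ | ⟨rfl, rfl⟩ | ⟨rfl, rfl, hD⟩ | ⟨rfl, rfl, hD⟩
    · exact ⟨(a, y, .hor), .inl ⟨rfl, rfl⟩⟩
    · exact ⟨(x, b, .ver), .inl ⟨rfl, rfl⟩⟩
    · exact ⟨(a, b, .diag), .inl ⟨by simp [triGridDrawing, triGridSrc, hD],
        by simp [triGridDrawing, triGridDst, hD]⟩⟩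
    · exact ⟨(a, y, .diag), .inl ⟨by simp [triGridDrawing, triGridSrc, hD],
        by simp [triGridDrawing, triGridDst, hD]⟩⟩

/-- Every finite graph embedded injectively in a triangulated grid is planar. -/
theorem isPlanarW_comap_triGrid {V : Type*} [Finite V] (D : ℤ → ℤ → Bool) (f : V → ℤ × ℤ)
    (hf : Function.Injective f) : IsPlanarW ((triGrid D).comap f) := by
  classical
  have : Fintype V := Fintype.ofFinite V
  rw [← triGridDrawing_graph D]
  set P := triGridDrawing D
  have hconn : ∀ S : Set V, ((P.graph.comap f).induce S).Connected →
      ConnIn P.graph ((S.toFinset.image f : Finset (ℤ × ℤ)) : Set (ℤ × ℤ)) := by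
    intro S hS
    rw [Finset.coe_image, Set.coe_toFinset]
    exact (connIn_iff_induce_connected.2 hS).image fun x _ y _ h => h
  have hdisj : ∀ S T : Set V, Disjoint S T →
      Disjoint (S.toFinset.image f) (T.toFinset.image f) := by
    intro S T h
    rw [Finset.disjoint_image hf, Set.disjoint_toFinset]
    exact h
  have hadj : ∀ S T : Set V, (∃ u ∈ S, ∃ v ∈ T, (P.graph.comap f).Adj u v) →
      ∃ u ∈ S.toFinset.image f, ∃ v ∈ T.toFinset.image f, P.graph.Adj u v := by
    rintro S T ⟨u, hu, v, hv, h⟩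
    exact ⟨f u, Finset.mem_image_of_mem _ (Set.mem_toFinset.2 hu), f v,
      Finset.mem_image_of_mem _ (Set.mem_toFinset.2 hv), h⟩
  constructor
  · rintro ⟨B, hB, hd, ha⟩
    exact P.no_K5_model (fun b => (B b).toFinset.image f) (fun b => hconn _ (hB b))
      (fun b b' h => hdisj _ _ (hd h)) (fun b b' h => hadj _ _ (ha b b' (by simpa using h)))
  · rintro ⟨B, hB, hd, ha⟩
    exact P.no_K33_model (fun b => (B b).toFinset.image f) (fun b => hconn _ (hB b))
      (fun b b' h => hdisj _ _ (hd h)) (fun i j => hadj _ _ (ha _ _ (by simp)))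

lemma connIn_component {V : Type*} {G : SimpleGraph V} {U : Set V} {u : V} :
    ConnIn G {v | ReachIn G U u v} := by
  refine ConnIn.of_base (u := u) (ReachIn.refl u) fun v hv => ?_
  change ReachIn G U u v at hv
  induction hv with
  | refl => exact ReachIn.refl _
  | tail h h' ih => exact ih.trans (ReachIn.single h'.1 h (ReachIn.trans h (.single h'.1 h'.2.1 h'.2.2)))

lemma triGrid_adj_right (D : ℤ → ℤ → Bool) (x y : ℤ) : (triGrid D).Adj (x, y) (x + 1, y) := by
  simp [triGrid]

lemma triGrid_adj_up (D : ℤ → ℤ → Bool) (x y : ℤ) : (triGrid D).Adj (x, y) (x, y + 1) := by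
  simp [triGrid]

lemma triGrid_adj_asc {D : ℤ → ℤ → Bool} {x y : ℤ} (h : D x y = true) :
    (triGrid D).Adj (x, y) (x + 1, y + 1) := by
  simp [triGrid, h]

lemma triGrid_adj_desc {D : ℤ → ℤ → Bool} {x y : ℤ} (h : D x y = false) :
    (triGrid D).Adj (x, y + 1) (x + 1, y) := by
  simp [triGrid, h]

/-- The lattice rectangle `[a, b] × [c, d]`. -/
def rect (a b c d : ℤ) : Set (ℤ × ℤ) := {p | a ≤ p.1 ∧ p.1 ≤ b ∧ c ≤ p.2 ∧ p.2 ≤ d}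

@[simp] lemma mem_rect {a b c d : ℤ} {p : ℤ × ℤ} :
    p ∈ rect a b c d ↔ a ≤ p.1 ∧ p.1 ≤ b ∧ c ≤ p.2 ∧ p.2 ≤ d := Iff.rfl

/-- Lattice points at `ℓ∞`-distance at most one. -/
def Near (p w : ℤ × ℤ) : Prop := |p.1 - w.1| ≤ 1 ∧ |p.2 - w.2| ≤ 1

/-- On a set of pairwise near points, a point is determined by the parities of its coordinates. -/
lemma parity_injOn_of_near (S : Finset (ℤ × ℤ)) (hS : ∀ p ∈ S, ∀ q ∈ S, Near p q) :
    Set.InjOn (fun p : ℤ × ℤ => ((p.1 : ZMod 2), (p.2 : ZMod 2))) S := by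
  intro p hp q hq h
  obtain ⟨h1, h2⟩ := hS p hp q hq
  simp only [Prod.mk.injEq, ZMod.intCast_eq_intCast_iff, Int.modEq_iff_dvd] at h
  rw [abs_le] at h1 h2
  ext <;> omega

lemma card_le_four_of_near (S : Finset (ℤ × ℤ)) (hS : ∀ p ∈ S, ∀ q ∈ S, Near p q) :
    S.card ≤ 4 := by
  rw [← Finset.card_image_of_injOn (parity_injOn_of_near S hS)]
  exact (Finset.card_le_univ _).trans (by simp)

/-- Four pairwise near points form a unit square, so each has a vertical neighbour among them. -/
lemma exists_vertical_of_near (S : Finset (ℤ × ℤ)) (hS : ∀ p ∈ S, ∀ q ∈ S, Near p q)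
    (hcard : 4 ≤ S.card) {p : ℤ × ℤ} (hp : p ∈ S) : ∃ e ∈ S, e.1 = p.1 ∧ e.2 ≠ p.2 := by
  have hcard' := Finset.card_image_of_injOn (parity_injOn_of_near S hS)
  have huniv : S.image (fun p : ℤ × ℤ => ((p.1 : ZMod 2), (p.2 : ZMod 2))) = Finset.univ :=
    Finset.eq_univ_of_card _ (le_antisymm (Finset.card_le_univ _) (by simpa [hcard'] using hcard))
  have := Finset.mem_univ ((p.1 : ZMod 2), ((p.2 + 1 : ℤ) : ZMod 2))
  rw [← huniv, Finset.mem_image] at this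
  obtain ⟨e, he, h⟩ := this
  obtain ⟨h1, h2⟩ := hS e he p hp
  simp only [Prod.mk.injEq, ZMod.intCast_eq_intCast_iff, Int.modEq_iff_dvd] at h
  rw [abs_le] at h1 h2
  exact ⟨e, he, by omega, by omega⟩

/-- `ψ` embeds the part of `triGrid D` inside `[0, X] × [0, Y]` into `G`. -/
structure BoxHom {V : Type*} (G : SimpleGraph V) (D : ℤ → ℤ → Bool) (X Y : ℤ) (ψ : ℤ × ℤ → V) :
    Prop where
  inj : Set.InjOn ψ (rect 0 X 0 Y)
  adj : ∀ p ∈ rect 0 X 0 Y, ∀ q ∈ rect 0 X 0 Y, (triGrid D).Adj p q → G.Adj (ψ p) (ψ q)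

/-- Away from row `β` all diagonals are prescribed. -/
def BitRow (β : ℤ) (D : ℤ → ℤ → Bool) : Prop :=
  (∀ x y, y < β → D x y = false) ∧ ∀ x y, β < y → D x y = true

/-- A connected set `J` in the image under `ψ'` of the columns `[l, r]` that meets the
image of `ψ` in exactly two points `ψ p`, `ψ w`. -/
structure IsJump {V : Type*} (G : SimpleGraph V) (ψ ψ' : ℤ × ℤ → V) (X Y l r : ℤ)
    (p w : ℤ × ℤ) (J : Set V) : Prop where
  left_mem : p ∈ rect 0 X 0 Y
  right_mem : w ∈ rect 0 X 0 Y
  left_image : ψ p ∈ J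
  right_image : ψ w ∈ J
  conn : ConnIn G J
  subset : J ⊆ (ψ') '' rect l r 0 Y
  eq_or_eq : ∀ z ∈ rect 0 X 0 Y, ψ z ∈ J → z = p ∨ z = w

/-- A jump starting near row `β` of the columns `[l, r]` and joining two points at distance at least
two. -/
def HasJump {V : Type*} (G : SimpleGraph V) (ψ ψ' : ℤ × ℤ → V) (X Y β l r : ℤ) : Prop :=
  ∃ p w J, IsJump G ψ ψ' X Y l r p w J ∧ p ∈ rect (l - 1) r (β - 3) (β + 4) ∧ ¬ Near p w

/-- A cell near row `β` of the columns `[l, r]` both of whose diagonals are present in `G`. -/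
def HasCross {V : Type*} (G : SimpleGraph V) (ψ : ℤ × ℤ → V) (β l r : ℤ) : Prop :=
  ∃ x y, l ≤ x ∧ x < r ∧ β - 2 ≤ y ∧ y ≤ β + 2 ∧
    G.Adj (ψ (x, y)) (ψ (x + 1, y + 1)) ∧ G.Adj (ψ (x, y + 1)) (ψ (x + 1, y))

/-- Two embedded grids agreeing on the columns bordering a gap `[l, r]`. -/
structure GapPair {V : Type*} (G : SimpleGraph V) (ψ ψ' : ℤ × ℤ → V) (D D' : ℤ → ℤ → Bool)
    (X Y β l r : ℤ) : Prop where
  hom : BoxHom G D X Y ψ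
  hom' : BoxHom G D' X Y ψ'
  bit : BitRow β D'
  one_le : 1 ≤ l
  le_right : r ≤ X
  low : 5 ≤ β
  high : β + 5 ≤ Y
  agree : ∀ x y, x = l - 1 ∨ x = l ∨ x = r → 0 ≤ y → y ≤ Y → ψ' (x, y) = ψ (x, y)

namespace GapPair

variable {V : Type*} {G : SimpleGraph V} {ψ ψ' : ℤ × ℤ → V} {D D' : ℤ → ℤ → Bool}
  {X Y β l r : ℤ}

section

variable (P : GapPair G ψ ψ' D D' X Y β l r) (hJ : ¬ HasJump G ψ ψ' X Y β l r)
include P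

lemma gap_subset {z : ℤ × ℤ} (hz : z ∈ rect l r 0 Y) : z ∈ rect 0 X 0 Y := by
  have := P.one_le
  have := P.le_right
  simp only [mem_rect] at *
  omega

include hJ

lemma near_of_connIn (Z : Set (ℤ × ℤ)) (hZ : Z ⊆ rect l r 0 Y)
    (hZc : ConnIn (triGrid D') Z) {z z' p w : ℤ × ℤ} (hz : z ∈ Z) (hz' : z' ∈ Z)
    (hhit : ∀ v ∈ Z, (∃ u ∈ rect 0 X 0 Y, ψ u = ψ' v) → v = z ∨ v = z')
    (hp : p ∈ rect 0 X 0 Y) (hw : w ∈ rect 0 X 0 Y) (hpz : ψ p = ψ' z) (hwz : ψ w = ψ' z')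
    (hpr : p ∈ rect (l - 1) r (β - 3) (β + 4)) : Near p w := by
  by_contra hnear
  refine hJ ⟨p, w, (ψ') '' Z, ⟨hp, hw, hpz ▸ ⟨z, hz, rfl⟩, hwz ▸ ⟨z', hz', rfl⟩, ?_, ?_, ?_⟩, hpr,
    hnear⟩
  · exact hZc.image fun x hx y hy h =>
      P.hom'.adj _ (P.gap_subset (hZ hx)) _ (P.gap_subset (hZ hy)) h
  · exact Set.image_mono hZ
  · rintro u hu ⟨v, hv, hvu⟩
    rcases hhit v hv ⟨u, hu, hvu.symm⟩ with rfl | rfl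
    · exact .inl (P.hom.inj hu hp (hvu.symm.trans hpz.symm))
    · exact .inr (P.hom.inj hu hw (hvu.symm.trans hwz.symm))

lemma near_of_adj {z z' p w : ℤ × ℤ} (hz : z ∈ rect l r 0 Y) (hz' : z' ∈ rect l r 0 Y)
    (hzz : (triGrid D').Adj z z') (hp : p ∈ rect 0 X 0 Y) (hw : w ∈ rect 0 X 0 Y)
    (hpz : ψ p = ψ' z) (hwz : ψ w = ψ' z') (hpr : p ∈ rect (l - 1) r (β - 3) (β + 4)) :
    Near p w :=
  P.near_of_connIn hJ {z, z'} (by rintro v (rfl | rfl) <;> assumption) (connIn_pair hzz)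
    (by simp) (by simp) (fun v hv _ => hv) hp hw hpz hwz hpr

end

/-- The points of the gap that `ψ'` does not map into the image of `ψ`. -/
def missed (ψ ψ' : ℤ × ℤ → V) (X Y l r : ℤ) : Set (ℤ × ℤ) :=
  {z | z ∈ rect l r 0 Y ∧ ¬ ∃ u ∈ rect 0 X 0 Y, ψ u = ψ' z}

/-- The points of the gap mapped into the image of `ψ` and adjacent to the component
of `q` among the missed points. -/
def rim (ψ ψ' : ℤ × ℤ → V) (D' : ℤ → ℤ → Bool) (X Y l r : ℤ) (q : ℤ × ℤ) : Set (ℤ × ℤ) :=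
  {z | z ∈ rect l r 0 Y ∧ (∃ u ∈ rect 0 X 0 Y, ψ u = ψ' z) ∧
    ∃ v, ReachIn (triGrid D') (missed ψ ψ' X Y l r) q v ∧ (triGrid D').Adj v z}

lemma mem_missed_of_reachIn {q v : ℤ × ℤ} (hq : q ∈ missed ψ ψ' X Y l r)
    (hv : ReachIn (triGrid D') (missed ψ ψ' X Y l r) q v) : v ∈ missed ψ ψ' X Y l r := by
  rcases Relation.ReflTransGen.cases_tail hv with rfl | ⟨_, _, h⟩
  · exact hq
  · exact h.2.2

lemma reach_or_rim {q v z : ℤ × ℤ} (hq : q ∈ missed ψ ψ' X Y l r)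
    (hv : ReachIn (triGrid D') (missed ψ ψ' X Y l r) q v)
    (hadj : (triGrid D').Adj v z) (hz : z ∈ rect l r 0 Y) :
    ReachIn (triGrid D') (missed ψ ψ' X Y l r) q z ∨ z ∈ rim ψ ψ' D' X Y l r q := by
  by_cases h : ∃ u ∈ rect 0 X 0 Y, ψ u = ψ' z
  · exact .inr ⟨hz, h, v, hv, hadj⟩
  · exact .inl (hv.trans (.single hadj (mem_missed_of_reachIn hq hv) ⟨hz, h⟩))

variable (P : GapPair G ψ ψ' D D' X Y β l r) (hJ : ¬ HasJump G ψ ψ' X Y β l r)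
include P

lemma notMem_missed {x y : ℤ} (hx : x = l ∨ x = r) : (x, y) ∉ missed ψ ψ' X Y l r := by
  rintro ⟨h, h'⟩
  have h2 := P.gap_subset h
  simp only [mem_rect] at h
  exact h' ⟨(x, y), h2, (P.agree x y (by omega) (by omega) (by omega)).symm⟩

lemma exists_rim_right {q : ℤ × ℤ} (hq : q ∈ missed ψ ψ' X Y l r) {a b : ℤ}
    (h : ReachIn (triGrid D') (missed ψ ψ' X Y l r) q (a, b)) :
    ∃ x, a < x ∧ (x, b) ∈ rim ψ ψ' D' X Y l r q := by
  induction hn : (r - a).toNat generalizing a with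
  | zero =>
    have h1 := mem_missed_of_reachIn hq h
    have h2 := h1.1
    simp only [mem_rect] at h2
    exact absurd h1 (P.notMem_missed (.inr (by omega)))
  | succ n ih =>
    have h1 := (mem_missed_of_reachIn hq h).1
    simp only [mem_rect] at h1
    rcases reach_or_rim hq h (triGrid_adj_right D' a b) (by simp only [mem_rect]; omega) with h | h
    · obtain ⟨x, hx, hx'⟩ := ih h (by omega)
      exact ⟨x, by omega, hx'⟩
    · exact ⟨a + 1, by omega, h⟩

lemma exists_rim_left {q : ℤ × ℤ} (hq : q ∈ missed ψ ψ' X Y l r) {a b : ℤ}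
    (h : ReachIn (triGrid D') (missed ψ ψ' X Y l r) q (a, b)) :
    ∃ x, x < a ∧ (x, b) ∈ rim ψ ψ' D' X Y l r q := by
  induction hn : (a - l).toNat generalizing a with
  | zero =>
    have h1 := mem_missed_of_reachIn hq h
    have h2 := h1.1
    simp only [mem_rect] at h2
    exact absurd h1 (P.notMem_missed (.inl (by omega)))
  | succ n ih =>
    have h1 := (mem_missed_of_reachIn hq h).1
    simp only [mem_rect] at h1
    have hadj := (triGrid_adj_right D' (a - 1) b).symm
    rw [sub_add_cancel] at hadj
    rcases reach_or_rim hq h hadj (by simp only [mem_rect]; omega) with h | h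
    · obtain ⟨x, hx, hx'⟩ := ih h (by omega)
      exact ⟨x, by omega, hx'⟩
    · exact ⟨a - 1, by omega, h⟩

include hJ

lemma near_of_rim {q z z' p w : ℤ × ℤ} (hq : q ∈ missed ψ ψ' X Y l r)
    (hz : z ∈ rim ψ ψ' D' X Y l r q) (hz' : z' ∈ rim ψ ψ' D' X Y l r q)
    (hp : p ∈ rect 0 X 0 Y) (hw : w ∈ rect 0 X 0 Y) (hpz : ψ p = ψ' z) (hwz : ψ w = ψ' z')
    (hpr : p ∈ rect (l - 1) r (β - 3) (β + 4)) : Near p w := by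
  obtain ⟨h1, -, v, hv, hvz⟩ := hz
  obtain ⟨h1', -, v', hv', hvz'⟩ := hz'
  refine P.near_of_connIn hJ
    (insert z (insert z' {x | ReachIn (triGrid D') (missed ψ ψ' X Y l r) q x})) ?_
    ((connIn_component.insert_adj hv' hvz').insert_adj (.inr hv) hvz) (.inl rfl)
    (.inr (.inl rfl)) ?_ hp hw hpz hwz hpr
  · rintro x (rfl | rfl | hx)
    · exact h1
    · exact h1'
    · exact (mem_missed_of_reachIn hq hx).1
  · rintro x (rfl | rfl | hx) h
    · exact .inl rfl
    · exact .inr rfl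
    · exact absurd h (mem_missed_of_reachIn hq hx).2

/-- If the columns up to `c` agree near row `β` then no point of column `c + 1` near row `β` is
missed. -/
lemma notMem_missed_of_agree {c y : ℤ} (hc : l ≤ c) (hy : β - 2 ≤ y) (hy' : y ≤ β + 3)
    (hagree : ∀ y, β - 2 ≤ y → y ≤ β + 3 → ψ' (c, y) = ψ (c, y)) :
    (c + 1, y) ∉ missed ψ ψ' X Y l r := by
  classical
  intro hq
  have hqr := hq.1
  have hlow := P.low
  have hhigh := P.high
  have hlr := P.le_right
  have hl := P.one_le
  simp only [mem_rect] at hqr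
  have hbox : ∀ {z}, z ∈ rim ψ ψ' D' X Y l r (c + 1, y) → z ∈ rect 0 X 0 Y :=
    fun h => P.gap_subset h.1
  have hcbox : ∀ b, β - 3 ≤ b → b ≤ β + 4 → (c, b) ∈ rect 0 X 0 Y := by
    intro b h1 h2; simp only [mem_rect]; omega
  have hex : ∀ z, ∃ u, z ∈ rim ψ ψ' D' X Y l r (c + 1, y) → u ∈ rect 0 X 0 Y ∧ ψ u = ψ' z := by
    intro z
    by_cases h : z ∈ rim ψ ψ' D' X Y l r (c + 1, y)
    · obtain ⟨u, hu⟩ := h.2.1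
      exact ⟨u, fun _ => hu⟩
    · exact ⟨z, fun h' => absurd h' h⟩
  choose π hπ using hex
  have hπinj : Set.InjOn π (rim ψ ψ' D' X Y l r (c + 1, y)) := by
    intro z hz z' hz' h
    exact P.hom'.inj (hbox hz) (hbox hz') (by rw [← (hπ z hz).2, ← (hπ z' hz').2, h])
  have hπne : ∀ z ∈ rim ψ ψ' D' X Y l r (c + 1, y), z.1 ≠ c → ∀ b, β - 2 ≤ b → b ≤ β + 3 →
      π z ≠ (c, b) := by
    intro z hz hzc b h1 h2 h
    have h3 := (hπ z hz).2
    rw [h, ← hagree b h1 h2] at h3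
    have := P.hom'.inj (hcbox b (by omega) (by omega)) (hbox hz) h3
    exact hzc (by rw [← this])
  have hrefl : ReachIn (triGrid D') (missed ψ ψ' X Y l r) (c + 1, y) (c + 1, y) := .refl _
  have hleft : (c, y) ∈ rim ψ ψ' D' X Y l r (c + 1, y) :=
    ⟨by simp only [mem_rect]; omega, ⟨(c, y), hcbox y (by omega) (by omega),
      (hagree y hy hy').symm⟩, _, hrefl, (triGrid_adj_right D' c y).symm⟩
  have hπleft : π (c, y) = (c, y) :=
    P.hom.inj (hπ _ hleft).1 (hcbox y (by omega) (by omega))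
      ((hπ _ hleft).2.trans (hagree y hy hy'))
  have hnear : ∀ z ∈ rim ψ ψ' D' X Y l r (c + 1, y), Near (c, y) (π z) := fun z hz =>
    P.near_of_rim hJ hq hleft hz (hcbox y (by omega) (by omega)) (hπ z hz).1
      (hagree y hy hy').symm (hπ z hz).2 (by simp only [mem_rect]; omega)
  have hnear' : ∀ z ∈ rim ψ ψ' D' X Y l r (c + 1, y), ∀ z' ∈ rim ψ ψ' D' X Y l r (c + 1, y),
      Near (π z) (π z') := by
    intro z hz z' hz'
    refine P.near_of_rim hJ hq hz hz' (hπ z hz).1 (hπ z' hz').1 (hπ z hz).2 (hπ z' hz').2 ?_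
    obtain ⟨h1, h2⟩ := hnear z hz
    rw [abs_le] at h1 h2
    simp only [mem_rect] at *
    omega
  have hfin : ∀ T : Finset (ℤ × ℤ), (∀ z ∈ T, z ∈ rim ψ ψ' D' X Y l r (c + 1, y)) →
      (T.image π).card = T.card ∧ ∀ p ∈ T.image π, ∀ q ∈ T.image π, Near p q := by
    intro T hT
    refine ⟨Finset.card_image_of_injOn fun z hz z' hz' h => hπinj (hT z hz) (hT z' hz') h, ?_⟩
    intro p hp q hq
    obtain ⟨z, hz, rfl⟩ := Finset.mem_image.1 hp
    obtain ⟨z', hz', rfl⟩ := Finset.mem_image.1 hq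
    exact hnear' z (hT z hz) z' (hT z' hz')
  obtain ⟨x, hx, hxr⟩ := P.exists_rim_right hq hrefl
  have hdownadj := (triGrid_adj_up D' (c + 1) (y - 1)).symm
  rw [sub_add_cancel] at hdownadj
  have hup := reach_or_rim hq hrefl (triGrid_adj_up D' (c + 1) y) (by simp only [mem_rect]; omega)
  have hdown := reach_or_rim hq hrefl hdownadj (by simp only [mem_rect]; omega)
  have hup' : ∃ x', (x', y + 1) ∈ rim ψ ψ' D' X Y l r (c + 1, y) := by
    rcases hup with h | h
    · obtain ⟨x', -, h⟩ := P.exists_rim_right hq h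
      exact ⟨x', h⟩
    · exact ⟨_, h⟩
  have hdown' : ∃ x', (x', y - 1) ∈ rim ψ ψ' D' X Y l r (c + 1, y) := by
    rcases hdown with h | h
    · obtain ⟨x', -, h⟩ := P.exists_rim_right hq h
      exact ⟨x', h⟩
    · exact ⟨_, h⟩
  have hfive : ∀ {a b d e : ℤ}, a < c + 1 → c + 1 < b → (d = y + 1 ∧ e = y - 1 ∨
      d = y - 1 ∧ e = y + 1) → (a, d) ∈ rim ψ ψ' D' X Y l r (c + 1, y) →
      (b, d) ∈ rim ψ ψ' D' X Y l r (c + 1, y) → (∃ x', (x', e) ∈ rim ψ ψ' D' X Y l r (c + 1, y)) →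
      False := by
    rintro a b d e ha hb hde h1 h2 ⟨x', h3⟩
    obtain ⟨h4, h5⟩ := hfin {(c, y), (x, y), (a, d), (b, d), (x', e)} (by
      simp only [Finset.mem_insert, Finset.mem_singleton]
      rintro z (rfl | rfl | rfl | rfl | rfl) <;> assumption)
    have h6 := card_le_four_of_near _ h5
    rw [h4] at h6
    have h7 : ({(c, y), (x, y), (a, d), (b, d), (x', e)} : Finset (ℤ × ℤ)).card = 5 := by
      repeat rw [Finset.card_insert_of_notMem (by
        simp only [Finset.mem_insert, Finset.mem_singleton, Prod.mk.injEq]; omega)]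
      rfl
    omega
  rcases hup with hup | hup
  · obtain ⟨a, ha, ha'⟩ := P.exists_rim_left hq hup
    obtain ⟨b, hb, hb'⟩ := P.exists_rim_right hq hup
    exact hfive ha hb (.inl ⟨rfl, rfl⟩) ha' hb' hdown'
  rcases hdown with hdown | hdown
  · obtain ⟨a, ha, ha'⟩ := P.exists_rim_left hq hdown
    obtain ⟨b, hb, hb'⟩ := P.exists_rim_right hq hdown
    exact hfive ha hb (.inr ⟨rfl, rfl⟩) ha' hb' hup'
  obtain ⟨h4, h5⟩ := hfin {(c, y), (x, y), (c + 1, y + 1), (c + 1, y - 1)} (by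
      simp only [Finset.mem_insert, Finset.mem_singleton]
      rintro z (rfl | rfl | rfl | rfl) <;> assumption)
  have h7 : ({(c, y), (x, y), (c + 1, y + 1), (c + 1, y - 1)} : Finset (ℤ × ℤ)).card = 4 := by
    repeat rw [Finset.card_insert_of_notMem (by
      simp only [Finset.mem_insert, Finset.mem_singleton, Prod.mk.injEq]; omega)]
    rfl
  obtain ⟨e, he, he1, he2⟩ := exists_vertical_of_near _ h5 (by omega) (p := (c, y))
    (Finset.mem_image.2 ⟨_, Finset.mem_insert_self _ _, hπleft⟩)
  obtain ⟨z, hz, rfl⟩ := Finset.mem_image.1 he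
  have hzrim : z ∈ rim ψ ψ' D' X Y l r (c + 1, y) ∧ (z = (c, y) ∨ z.1 ≠ c) := by
    simp only [Finset.mem_insert, Finset.mem_singleton] at hz
    rcases hz with rfl | rfl | rfl | rfl
    · exact ⟨hleft, .inl rfl⟩
    · exact ⟨hxr, .inr (by simp; omega)⟩
    · exact ⟨hup, .inr (by simp)⟩
    · exact ⟨hdown, .inr (by simp)⟩
  have hzc : z.1 ≠ c := hzrim.2.resolve_left fun h => he2 (by rw [h, hπleft])
  have hne := hπne z hzrim.1 hzc (π z).2
  obtain ⟨-, hn2⟩ := hnear z hzrim.1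
  rw [abs_le] at hn2
  have hout : ¬ (β - 2 ≤ (π z).2 ∧ (π z).2 ≤ β + 3) := fun h =>
    hne h.1 h.2 (Prod.ext he1 rfl)
  simp only at hn2 he2
  rcases (by omega : y = β + 3 ∧ (π z).2 = y + 1 ∨ y = β - 2 ∧ (π z).2 = y - 1) with
    ⟨hyβ, hzy⟩ | ⟨hyβ, hzy⟩
  · have hadj := triGrid_adj_asc (P.bit.2 c (y - 2) (by omega))
    rw [show y - 2 + 1 = y - 1 by ring] at hadj
    have h8 := P.near_of_adj hJ (by simp only [mem_rect]; omega) hdown.1 hadj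
      (hcbox (y - 2) (by omega) (by omega)) (hπ _ hdown).1
      (hagree (y - 2) (by omega) (by omega)).symm (hπ _ hdown).2
      (by simp only [mem_rect]; omega)
    have h9 := hnear' _ hzrim.1 _ hdown
    have h10 := h8.2
    have h11 := h9.2
    rw [abs_le] at h10 h11
    simp only at h10
    omega
  · have hadj := triGrid_adj_desc (P.bit.1 c (y + 1) (by omega))
    rw [show y + 1 + 1 = y + 2 by ring] at hadj
    have h8 := P.near_of_adj hJ (by simp only [mem_rect]; omega) hup.1 hadj
      (hcbox (y + 2) (by omega) (by omega)) (hπ _ hup).1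
      (hagree (y + 2) (by omega) (by omega)).symm (hπ _ hup).2
      (by simp only [mem_rect]; omega)
    have h9 := hnear' _ hzrim.1 _ hup
    have h10 := h8.2
    have h11 := h9.2
    rw [abs_le] at h10 h11
    simp only at h10
    omega

lemma agree_succ (hX : ¬ HasCross G ψ β l r) {c : ℤ} (hc : l ≤ c) (hcr : c + 1 < r)
    (hagree : ∀ x y, x = c - 1 ∨ x = c → β - 2 ≤ y → y ≤ β + 3 → ψ' (x, y) = ψ (x, y)) :
    ∀ y, β - 2 ≤ y → y ≤ β + 3 → ψ' (c + 1, y) = ψ (c + 1, y) := by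
  have hlow := P.low
  have hhigh := P.high
  have hlr := P.le_right
  have hl := P.one_le
  have hcbox : ∀ x b, c - 1 ≤ x → x ≤ c + 1 → β - 3 ≤ b → b ≤ β + 4 → (x, b) ∈ rect 0 X 0 Y := by
    intro x b h1 h2 h3 h4; simp only [mem_rect]; omega
  have hgap : ∀ x b, c ≤ x → x ≤ c + 1 → β - 3 ≤ b → b ≤ β + 4 → (x, b) ∈ rect l r 0 Y := by
    intro x b h1 h2 h3 h4; simp only [mem_rect]; omega
  have hz : ∀ y, ∃ z, β - 2 ≤ y → y ≤ β + 3 → ψ (c + 1, z) = ψ' (c + 1, y) ∧ y - 1 ≤ z ∧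
      z ≤ y + 1 ∧ β - 2 ≤ z ∧ z ≤ β + 3 := by
    intro y
    by_cases hy : β - 2 ≤ y ∧ y ≤ β + 3
    swap
    · exact ⟨0, fun h h' => absurd ⟨h, h'⟩ hy⟩
    have hmiss := P.notMem_missed_of_agree hJ hc hy.1 hy.2 fun b => hagree c b (.inr rfl)
    have hhit : ∃ u ∈ rect 0 X 0 Y, ψ u = ψ' (c + 1, y) := by
      by_contra h
      exact hmiss ⟨hgap _ _ (by omega) le_rfl (by omega) (by omega), h⟩
    obtain ⟨⟨a, b⟩, hu, hu'⟩ := hhit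
    have hnear : ∀ y', β - 2 ≤ y' → y' ≤ β + 3 → (triGrid D').Adj (c, y') (c + 1, y) →
        Near (c, y') (a, b) := fun y' h1 h2 h3 =>
      P.near_of_adj hJ (hgap _ _ (by omega) (by omega) (by omega) (by omega))
        (hgap _ _ (by omega) (by omega) (by omega) (by omega)) h3
        (hcbox _ _ (by omega) (by omega) (by omega) (by omega)) hu
        (hagree c y' (.inr rfl) h1 h2).symm hu' (by simp only [mem_rect]; omega)
    have h1 := hnear y hy.1 hy.2 (triGrid_adj_right D' c y)
    have h2 : y = β + 3 → b ≤ y := by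
      intro h
      have hadj := triGrid_adj_asc (P.bit.2 c (y - 1) (by omega))
      rw [sub_add_cancel] at hadj
      have := (hnear (y - 1) (by omega) (by omega) hadj).2
      rw [abs_le] at this
      simp only at this
      omega
    have h3 : y = β - 2 → y ≤ b := by
      intro h
      have hadj := triGrid_adj_desc (P.bit.1 c y (by omega))
      have := (hnear (y + 1) (by omega) (by omega) hadj).2
      rw [abs_le] at this
      simp only at this
      omega
    simp only [Near, abs_le] at h1
    have h4 : a = c + 1 := by
      by_contra ha
      have h5 := hagree a b (by omega) (by omega) (by omega)
      have h6 := P.hom'.inj hu (hcbox (c + 1) y (by omega) (by omega) (by omega) (by omega))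
        (h5.trans hu')
      simp only [Prod.mk.injEq] at h6
      omega
    subst h4
    exact ⟨b, fun _ _ => ⟨hu', by omega, by omega, by omega, by omega⟩⟩
  choose z hz using hz
  have hinj : ∀ y, β - 2 ≤ y → y ≤ β + 2 → z y ≠ z (y + 1) := by
    intro y h1 h2 h
    have h3 := (hz y h1 (by omega)).1
    rw [h, (hz (y + 1) (by omega) (by omega)).1] at h3
    have h4 := P.hom'.inj (hcbox (c + 1) (y + 1) (by omega) (by omega) (by omega) (by omega))
      (hcbox (c + 1) y (by omega) (by omega) (by omega) (by omega)) h3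
    simp at h4
  have hinj2 : ∀ y, β - 2 ≤ y → y ≤ β + 1 → z y ≠ z (y + 2) := by
    intro y h1 h2 h
    have h3 := (hz y h1 (by omega)).1
    rw [h, (hz (y + 2) (by omega) (by omega)).1] at h3
    have h4 := P.hom'.inj (hcbox (c + 1) (y + 2) (by omega) (by omega) (by omega) (by omega))
      (hcbox (c + 1) y (by omega) (by omega) (by omega) (by omega)) h3
    simp at h4
  have hswap : ∀ y, β - 2 ≤ y → y ≤ β + 2 → ¬ (z y = y + 1 ∧ z (y + 1) = y) := by
    rintro y h1 h2 ⟨h3, h4⟩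
    have h5 := (hz y h1 (by omega)).1
    have h6 := (hz (y + 1) (by omega) (by omega)).1
    rw [h3] at h5
    rw [h4] at h6
    refine hX ⟨c, y, hc, by omega, h1, h2, ?_, ?_⟩
    · rw [h5, ← hagree c y (.inr rfl) h1 (by omega)]
      exact P.hom'.adj _ (hcbox _ _ (by omega) (by omega) (by omega) (by omega)) _
        (hcbox _ _ (by omega) (by omega) (by omega) (by omega)) (triGrid_adj_right _ _ _)
    · rw [h6, ← hagree c (y + 1) (.inr rfl) (by omega) (by omega)]
      exact P.hom'.adj _ (hcbox _ _ (by omega) (by omega) (by omega) (by omega)) _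
        (hcbox _ _ (by omega) (by omega) (by omega) (by omega)) (triGrid_adj_right _ _ _)
  have hup : ∀ n : ℕ, ∀ y, y = β + 3 - n → β - 2 ≤ y → z y ≤ y := by
    intro n
    induction n with
    | zero =>
      intro y h1 h2
      have := (hz y h2 (by omega)).2
      push_cast at h1
      omega
    | succ n ih =>
      intro y h1 h2
      push_cast at h1
      have h3 := ih (y + 1) (by omega) (by omega)
      have h4 := (hz y h2 (by omega)).2
      have h5 := (hz (y + 1) (by omega) (by omega)).2
      have h6 := hinj y h2 (by omega)
      have h7 := hswap y h2 (by omega)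
      omega
  have hdown : ∀ n : ℕ, ∀ y, y = β - 2 + n → y ≤ β + 3 → y ≤ z y := by
    intro n
    induction n with
    | zero =>
      intro y h1 h2
      have := (hz y (by omega) h2).2
      push_cast at h1
      omega
    | succ n ih =>
      intro y h1 h2
      push_cast at h1
      have h3 := ih (y - 1) (by omega) (by omega)
      have h4 := (hz y (by omega) h2).2
      have h5 := (hz (y - 1) (by omega) (by omega)).2
      have h6 := hinj (y - 1) (by omega) (by omega)
      have h7 := hswap (y - 1) (by omega) (by omega)
      rw [sub_add_cancel] at h6 h7
      omega
  intro y h1 h2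
  have h3 := hup (β + 3 - y).toNat y (by omega) h1
  have h4 := hdown (y - (β - 2)).toNat y (by omega) h2
  rw [← (hz y h1 h2).1, le_antisymm h3 h4]

omit hJ in
/-- If the two grids have different diagonals in row `β` of the gap, then there is a jump or a
cross. -/
theorem hasJump_or_hasCross {c : ℤ} (hc : l ≤ c) (hcr : c < r) (hD : D c β ≠ D' c β) :
    HasJump G ψ ψ' X Y β l r ∨ HasCross G ψ β l r := by
  by_contra h
  obtain ⟨hJ, hX⟩ := not_or.1 h
  have hlow := P.low
  have hhigh := P.high
  have hlr := P.le_right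
  have hl := P.one_le
  have key : ∀ n : ℕ, l + n ≤ r → ∀ x y, x = l + n - 1 ∨ x = l + n → β - 2 ≤ y → y ≤ β + 3 →
      ψ' (x, y) = ψ (x, y) := by
    intro n
    induction n with
    | zero =>
      intro _ x y hx h1 h2
      exact P.agree x y (by push_cast at hx; omega) (by omega) (by omega)
    | succ n ih =>
      intro hn x y hx h1 h2
      push_cast at hn hx
      rcases hx with hx | hx
      · exact ih (by omega) x y (by omega) h1 h2
      · rcases (by omega : x = r ∨ l + n + 1 < r) with h | h
        · exact P.agree x y (by omega) (by omega) (by omega)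
        · have := P.agree_succ hJ hX (c := l + n) (by omega) h (ih (by omega)) y h1 h2
          rwa [show l + (n : ℤ) + 1 = x by omega] at this
  have hag : ∀ x y, x = c ∨ x = c + 1 → β - 2 ≤ y → y ≤ β + 3 → ψ' (x, y) = ψ (x, y) := by
    intro x y hx
    exact key (c + 1 - l).toNat (by omega) x y (by omega)
  have hbox : ∀ x b, c ≤ x → x ≤ c + 1 → β - 3 ≤ b → b ≤ β + 4 → (x, b) ∈ rect 0 X 0 Y := by
    intro x b h1 h2 h3 h4; simp only [mem_rect]; omega
  have hadj : ∀ E : ℤ → ℤ → Bool, ∀ φ : ℤ × ℤ → V, BoxHom G E X Y φ →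
      (∀ x y, x = c ∨ x = c + 1 → β - 2 ≤ y → y ≤ β + 3 → φ (x, y) = ψ (x, y)) →
      (E c β = true → G.Adj (ψ (c, β)) (ψ (c + 1, β + 1))) ∧
      (E c β = false → G.Adj (ψ (c, β + 1)) (ψ (c + 1, β))) := by
    intro E φ hφ h
    constructor
    · intro hE
      rw [← h _ _ (.inl rfl) (by omega) (by omega), ← h _ _ (.inr rfl) (by omega) (by omega)]
      exact hφ.adj _ (hbox _ _ (by omega) (by omega) (by omega) (by omega)) _
        (hbox _ _ (by omega) (by omega) (by omega) (by omega)) (triGrid_adj_asc hE)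
    · intro hE
      rw [← h _ _ (.inl rfl) (by omega) (by omega), ← h _ _ (.inr rfl) (by omega) (by omega)]
      exact hφ.adj _ (hbox _ _ (by omega) (by omega) (by omega) (by omega)) _
        (hbox _ _ (by omega) (by omega) (by omega) (by omega)) (triGrid_adj_desc hE)
  have h1 := hadj D ψ P.hom fun _ _ _ _ _ => rfl
  have h2 := hadj D' ψ' P.hom' hag
  refine hX ⟨c, β, hc, hcr, by omega, by omega, ?_⟩
  rcases hd : D c β with _ | _ <;> rcases hd' : D' c β with _ | _ <;> grind

end GapPair

/-- The square grid on `ℤ × ℤ`. -/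
def grid : SimpleGraph (ℤ × ℤ) :=
  SimpleGraph.fromRel fun p q => (q.1 = p.1 + 1 ∧ q.2 = p.2) ∨ (q.1 = p.1 ∧ q.2 = p.2 + 1)

/-- The square grid together with virtual edges joining `p k` to `w k`. -/
def jumpGrid {κ : Type*} (p w : κ → ℤ × ℤ) : SimpleGraph (ℤ × ℤ) :=
  grid ⊔ SimpleGraph.fromRel fun u v => ∃ k, u = p k ∧ v = w k

lemma grid_le_triGrid (D : ℤ → ℤ → Bool) : grid ≤ triGrid D := by
  intro u v h
  simp only [grid, triGrid, SimpleGraph.fromRel_adj] at *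
  tauto

/-- Pairwise disjoint connected sets `J k`, each meeting the embedded rectangle exactly in
the two points `ψ (p k)` and `ψ (w k)`. -/
structure JumpSystem {V κ : Type*} (G : SimpleGraph V) (X Y : ℤ) (ψ : ℤ × ℤ → V)
    (p w : κ → ℤ × ℤ) (J : κ → Set V) : Prop where
  left_image : ∀ k, ψ (p k) ∈ J k
  right_image : ∀ k, ψ (w k) ∈ J k
  conn : ∀ k, ConnIn G (J k)
  eq_or_eq : ∀ k, ∀ z ∈ rect 0 X 0 Y, ψ z ∈ J k → z = p k ∨ z = w k
  disjoint : ∀ k k', k ≠ k' → Disjoint (J k) (J k')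

/-- Disjoint connected pairwise touching sets of the graph `H`, inside `[0, X] × [0, Y]`. Touching
means joined by an edge of the square grid. -/
structure GridModel (t : ℕ) (H : SimpleGraph (ℤ × ℤ)) (X Y : ℤ) (S : Fin t → Set (ℤ × ℤ)) :
    Prop where
  subset : ∀ i, S i ⊆ rect 0 X 0 Y
  conn : ∀ i, ConnIn H (S i)
  disjoint : ∀ i j, i ≠ j → Disjoint (S i) (S j)
  touch : ∀ i j, i ≠ j → ∃ u ∈ S i, ∃ v ∈ S j, grid.Adj u v

theorem JumpSystem.hasMinor {V κ : Type*} {G : SimpleGraph V} {X Y : ℤ} {ψ : ℤ × ℤ → V}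
    {p w : κ → ℤ × ℤ} {J : κ → Set V} (hJ : JumpSystem G X Y ψ p w J) {D : ℤ → ℤ → Bool}
    (hψ : BoxHom G D X Y ψ) {t : ℕ} {S : Fin t → Set (ℤ × ℤ)}
    (hS : GridModel t (jumpGrid p w) X Y S) : G.HasMinor (⊤ : SimpleGraph (Fin t)) := by
  have hgrid : ∀ i j, ∀ u ∈ S i, ∀ v ∈ S j, grid.Adj u v → G.Adj (ψ u) (ψ v) :=
    fun i j u hu v hv h =>
      hψ.adj u (hS.subset i hu) v (hS.subset j hv) (grid_le_triGrid D h)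
  refine hasMinor_top_of_connIn
    (fun i => ψ '' S i ∪ {x | ∃ k, p k ∈ S i ∧ w k ∈ S i ∧ x ∈ J k}) ?_ ?_ ?_
  · intro i
    have hreach : ∀ u ∈ S i, ∀ v ∈ S i, ReachIn G
        (ψ '' S i ∪ {x | ∃ k, p k ∈ S i ∧ w k ∈ S i ∧ x ∈ J k}) (ψ u) (ψ v) := by
      intro u hu v hv
      refine ((hS.conn i).2 u hu v hv).map fun x hx y hy hxy => ?_
      have hjump : ∀ x ∈ S i, ∀ y ∈ S i, (∃ k, x = p k ∧ y = w k) → ReachIn G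
          (ψ '' S i ∪ {x | ∃ k, p k ∈ S i ∧ w k ∈ S i ∧ x ∈ J k}) (ψ x) (ψ y) := by
        rintro _ hx _ hy ⟨k, rfl, rfl⟩
        exact ((hJ.conn k).2 _ (hJ.left_image k) _ (hJ.right_image k)).mono
          fun z hz => .inr ⟨k, hx, hy, hz⟩
      rcases hxy with h | h
      · exact .single (hgrid i i x hx y hy h) (.inl ⟨x, hx, rfl⟩) (.inl ⟨y, hy, rfl⟩)
      · rcases h.2 with h | h
        · exact hjump x hx y hy h
        · exact (hjump y hy x hx h).symm
    obtain ⟨u, hu⟩ := (hS.conn i).1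
    refine ConnIn.of_base (.inl ⟨u, hu, rfl⟩) ?_
    rintro _ (⟨v, hv, rfl⟩ | ⟨k, hp, hw, hx⟩)
    · exact hreach u hu v hv
    · exact (hreach u hu _ hp).trans (((hJ.conn k).2 _ (hJ.left_image k) _ hx).mono
        fun z hz => .inr ⟨k, hp, hw, hz⟩)
  · intro i j hij
    have hd : ∀ {x}, x ∈ S i → x ∈ S j → False := fun h h' =>
      Set.disjoint_left.1 (hS.disjoint i j hij) h h'
    rw [Set.disjoint_left]
    rintro _ (⟨u, hu, rfl⟩ | ⟨k, hp, hw, hx⟩) (⟨v, hv, hv'⟩ | ⟨k', hp', hw', hx'⟩)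
    · exact hd hu (hψ.inj (hS.subset j hv) (hS.subset i hu) hv' ▸ hv)
    · rcases hJ.eq_or_eq k' u (hS.subset i hu) hx' with rfl | rfl
      · exact hd hu hp'
      · exact hd hu hw'
    · subst hv'
      rcases hJ.eq_or_eq k v (hS.subset j hv) hx with rfl | rfl
      · exact hd hp hv
      · exact hd hw hv
    · by_cases h : k = k'
      · subst h
        exact hd hp hp'
      · exact Set.disjoint_left.1 (hJ.disjoint k k' h) hx hx'
  · intro i j hij
    obtain ⟨u, hu, v, hv, h⟩ := hS.touch i j hij
    exact ⟨ψ u, .inl ⟨u, hu, rfl⟩, ψ v, .inl ⟨v, hv, rfl⟩, hgrid i j u hu v hv h⟩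

lemma grid_adj_right (x y : ℤ) : grid.Adj (x, y) (x + 1, y) := by simp [grid]

lemma grid_adj_up (x y : ℤ) : grid.Adj (x, y) (x, y + 1) := by simp [grid]

section

variable {H : SimpleGraph (ℤ × ℤ)} (hH : grid ≤ H) {S : Set (ℤ × ℤ)}
include hH

/-- A horizontal segment inside `S` joins its endpoints. -/
lemma reachIn_row {a b y : ℤ} (hab : a ≤ b) (h : ∀ x, a ≤ x → x ≤ b → (x, y) ∈ S) :
    ReachIn H S (a, y) (b, y) := by
  obtain ⟨n, hn⟩ := Int.eq_ofNat_of_zero_le (sub_nonneg.2 hab)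
  obtain rfl : b = a + n := by omega
  clear hn hab
  induction n with
  | zero => simpa using ReachIn.refl _
  | succ n ih =>
    have h1 := ih fun x h1 h2 => h x h1 (by push_cast; omega)
    refine h1.trans ?_
    have h2 := grid_adj_right (a + n) y
    rw [add_assoc] at h2
    push_cast at *
    exact .single (hH h2) (h _ (by omega) (by omega)) (h _ (by omega) (by omega))

/-- A vertical segment inside `S` joins its endpoints. -/
lemma reachIn_col {a b x : ℤ} (hab : a ≤ b) (h : ∀ y, a ≤ y → y ≤ b → (x, y) ∈ S) :
    ReachIn H S (x, a) (x, b) := by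
  obtain ⟨n, hn⟩ := Int.eq_ofNat_of_zero_le (sub_nonneg.2 hab)
  obtain rfl : b = a + n := by omega
  clear hn hab
  induction n with
  | zero => simpa using ReachIn.refl _
  | succ n ih =>
    have h1 := ih fun x h1 h2 => h x h1 (by push_cast; omega)
    refine h1.trans ?_
    have h2 := grid_adj_up x (a + n)
    rw [add_assoc] at h2
    push_cast at *
    exact .single (hH h2) (h _ (by omega) (by omega)) (h _ (by omega) (by omega))

end

lemma grid_le_jumpGrid {κ : Type*} (p w : κ → ℤ × ℤ) : grid ≤ jumpGrid p w := le_sup_left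

lemma jumpGrid_adj {κ : Type*} (p w : κ → ℤ × ℤ) (k : κ) (h : p k ≠ w k) :
    (jumpGrid p w).Adj (p k) (w k) := .inr ⟨h, .inl ⟨k, rfl, rfl⟩⟩

/-- The lattice path following the graph of `f` over the columns `[a, b]`. -/
def lane (f : ℤ → ℤ) (a b : ℤ) : Set (ℤ × ℤ) :=
  {p | a ≤ p.1 ∧ p.1 ≤ b ∧ (p.2 = f p.1 ∨ p.2 = f (p.1 + 1))}

lemma reachIn_lane {H : SimpleGraph (ℤ × ℤ)} (hH : grid ≤ H) {f : ℤ → ℤ}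
    (hf : ∀ x, |f (x + 1) - f x| ≤ 1) {a b : ℤ} {S : Set (ℤ × ℤ)} (hS : lane f a b ⊆ S) :
    ∀ p ∈ lane f a b, ReachIn H S (a, f a) p := by
  have hvert : ∀ x, a ≤ x → x ≤ b → ReachIn H S (x, f x) (x, f (x + 1)) := by
    intro x h1 h2
    have h3 := hf x
    rw [abs_le] at h3
    have hmem : ∀ y, y = f x ∨ y = f (x + 1) → (x, y) ∈ S := fun y hy => hS ⟨h1, h2, hy⟩
    rcases le_total (f x) (f (x + 1)) with h | h
    · exact reachIn_col hH h fun y h4 h5 => hmem y (by omega)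
    · exact (reachIn_col hH h fun y h4 h5 => hmem y (by omega)).symm
  have key : ∀ n : ℕ, a + n ≤ b → ReachIn H S (a, f a) (a + n, f (a + n)) := by
    intro n
    induction n with
    | zero => intro _; simpa using ReachIn.refl _
    | succ n ih =>
      intro hn
      push_cast at hn ⊢
      refine (ih (by omega)).trans ((hvert _ (by omega) (by omega)).trans ?_)
      rw [← add_assoc]
      exact .single (hH (grid_adj_right _ _)) (hS ⟨by simp, by simp; omega, .inr rfl⟩)
        (hS ⟨by simp; omega, by simp; omega, .inl rfl⟩)
  rintro ⟨x, y⟩ ⟨h1, h2, h3⟩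
  simp only at h1 h2 h3
  have h4 := key (x - a).toNat (by omega)
  rw [show a + ((x - a).toNat : ℤ) = x by omega] at h4
  rcases h3 with rfl | rfl
  · exact h4
  · exact h4.trans (hvert x h1 h2)

/-- A sum of tent functions with peaks of height `e j` at sparse points `a j`. -/
lemma exists_tent {ι : Type*} [Fintype ι] (a : ι → ℤ) (e : ι → ℕ) (M : ℕ) (he : ∀ j, e j ≤ M)
    (haa : ∀ j j', j ≠ j' → (M : ℤ) ≤ |a j - a j'|) :
    ∃ m : ℤ → ℤ, (∀ x, 0 ≤ m x) ∧ (∀ x, m x ≤ M) ∧ (∀ x, |m (x + 1) - m x| ≤ 1) ∧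
      (∀ j, m (a j) = e j) ∧ ∀ x, (∀ j, (M : ℤ) ≤ |x - a j|) → m x = 0 := by
  obtain ⟨m, hmj, hmle⟩ : ∃ m : ℤ → ℕ, (∀ x j, (e j : ℤ) - |x - a j| ≤ m x) ∧
      ∀ x (n : ℕ), (∀ j, (e j : ℤ) - |x - a j| ≤ n) → m x ≤ n := by
    refine ⟨fun x => Finset.univ.sup fun j => ((e j : ℤ) - |x - a j|).toNat, fun x j => ?_,
      fun x n h => Finset.sup_le fun j _ => ?_⟩
    · have := Finset.le_sup (f := fun j => ((e j : ℤ) - |x - a j|).toNat) (Finset.mem_univ j)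
      simp only at this ⊢
      omega
    · have := h j
      omega
  have hstep : ∀ x x', |x - x'| = 1 → m x ≤ m x' + 1 := by
    intro x x' h
    refine hmle _ _ fun j => ?_
    have h1 := hmj x' j
    have h2 := abs_sub_le x' x (a j)
    rw [abs_sub_comm x' x, h] at h2
    push_cast
    omega
  refine ⟨fun x => m x, fun x => by positivity, fun x => ?_, fun x => ?_, fun j => ?_,
    fun x hx => ?_⟩
  · have := hmle x M fun j => by
      have := he j
      have := abs_nonneg (x - a j)
      omega
    simp only
    exact_mod_cast this
  · have h1 := hstep (x + 1) x (by simp)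
    have h2 := hstep x (x + 1) (by simp)
    simp only [abs_le]
    omega
  · have h1 := hmj (a j) j
    have h2 : m (a j) ≤ e j := hmle _ _ fun j' => by
      by_cases h : j = j'
      · subst h; simp
      · have := haa j j' h
        have := he j'
        omega
    simp only [sub_self, abs_zero] at h1 ⊢
    omega
  · have h := hmle x 0 fun j => by
      have := hx j
      have := he j
      push_cast
      omega
    simp only
    omega

/-- Long jumps from row `b` to row `d ≥ b` produce a grid model of `K_t`: every branch set contains
a long horizontal track, and the jumps allow access to the region above all tracks. -/
lemma exists_gridModel_of_far_up {t : ℕ} (a c : Fin t × Fin t × Bool → ℤ) (b d X Y : ℤ)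
    (ha : ∀ j, 0 ≤ a j ∧ a j ≤ X) (hc : ∀ j, 0 ≤ c j ∧ c j ≤ X)
    (haa : ∀ j j', j ≠ j' → 2 * (t : ℤ) ≤ |a j - a j'|)
    (hca : ∀ j j', j ≠ j' → 2 * (t : ℤ) ≤ |c j - a j'|)
    (hown : ∀ j, 2 * (t : ℤ) ≤ |c j - a j| ∨ b + 2 * t < d)
    (hbd : b ≤ d) (hdY : d ≤ Y) (hb : 2 * (t : ℤ) ≤ b) (hbY : b + 2 * t < Y)
    (hlt : ∀ i i', c (i, i', false) < c (i, i', true))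
    (hsep : ∀ i i' k k', (i, i') ≠ (k, k') → c (i, i', true) < c (k, k', false) ∨
      c (k, k', true) < c (i, i', false)) :
    ∃ S, GridModel t (jumpGrid (fun j => (a j, b)) (fun j => (c j, d))) X Y S := by
  rcases Nat.eq_zero_or_pos t with rfl | ht
  · exact ⟨fun _ => ∅, fun i => i.elim0, fun i => i.elim0, fun i => i.elim0, fun i => i.elim0⟩
  let lv : Fin t × Fin t × Bool → Fin t := fun j => if j.2.2 then j.2.1 else j.1
  obtain ⟨m, hm0, hm2t, hmlip, hma, hmz⟩ := exists_tent a (fun j => 2 * t - 2 * (lv j : ℕ)) (2 * t)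
    (fun j => Nat.sub_le _ _) (by exact_mod_cast haa)
  push_cast at hm2t hmz
  have hma' : ∀ j, m (a j) = 2 * t - 2 * (lv j : ℤ) := by
    intro j
    have := (lv j).2
    rw [hma j]
    push_cast [Nat.cast_sub (show 2 * (lv j : ℕ) ≤ 2 * t by omega)]
    ring
  have hup : ∀ x, m (x + 1) ≤ m x + 1 ∧ m x ≤ m (x + 1) + 1 := by
    intro x
    have := hmlip x
    rw [abs_le] at this
    omega
  have hmc : ∀ j, m (c j) = 0 ∨ b + 2 * t < d := by
    intro j
    refine (hown j).imp_left fun h => hmz _ fun j' => ?_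
    by_cases h' : j = j'
    · exact h' ▸ h
    · exact hca j j' h'
  let T : Fin t → Set (ℤ × ℤ) := fun i => lane (fun x => b - 2 * t + m x + 2 * i) 0 X
  let C : Fin t → Set (ℤ × ℤ) := fun i => {p | ∃ j, lv j = i ∧ p.1 = c j ∧ d ≤ p.2 ∧ p.2 ≤ Y}
  let R : Fin t → Set (ℤ × ℤ) := fun i => {p | ∃ i', c (i, i', false) ≤ p.1 ∧ p.1 < c (i, i', true) ∧
    p.2 = Y}
  have hX : 0 ≤ X := (ha (⟨0, ht⟩, ⟨0, ht⟩, true)).1.trans (ha (⟨0, ht⟩, ⟨0, ht⟩, true)).2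
  have hH : grid ≤ jumpGrid (fun j => (a j, b)) (fun j => (c j, d)) := grid_le_jumpGrid _ _
  have hcinj : ∀ j j', c j = c j' → j = j' := by
    rintro ⟨i, i', e⟩ ⟨k, k', e'⟩ h
    have h1 := hlt i i'
    have h2 := hlt k k'
    by_cases hik : (i, i') = (k, k')
    · simp only [Prod.mk.injEq] at hik
      obtain ⟨rfl, rfl⟩ := hik
      cases e <;> cases e' <;> first | rfl | omega
    · have h3 := hsep i i' k k' hik
      cases e <;> cases e' <;> omega
  have hcR : ∀ j i i', c (i, i', false) ≤ c j → c j < c (i, i', true) → j = (i, i', false) := by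
    rintro ⟨k, k', e⟩ i i' h1 h2
    have h3 := hlt k k'
    by_cases hik : (i, i') = (k, k')
    · simp only [Prod.mk.injEq] at hik
      obtain ⟨rfl, rfl⟩ := hik
      cases e
      · rfl
      · omega
    · have h3 := hsep i i' k k' hik
      cases e <;> omega
  refine ⟨fun i => T i ∪ C i ∪ R i, ?_, ?_, ?_, ?_⟩
  · rintro i ⟨x, y⟩ ((⟨h1, h2, h3⟩ | ⟨j, -, h1, h2⟩) | ⟨i', h1, h2, h3⟩)
    · have := hm2t x
      have := hm2t (x + 1)
      have := hm0 x
      have := hm0 (x + 1)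
      have := i.2
      simp only [mem_rect] at *
      omega
    · have := hc j
      simp only [mem_rect] at *
      omega
    · have := hc (i, i', false)
      have := hc (i, i', true)
      simp only [mem_rect] at *
      omega
  · intro i
    have hTi : T i ⊆ T i ∪ C i ∪ R i := fun p hp => .inl (.inl hp)
    have hlane := reachIn_lane hH (f := fun x => b - 2 * t + m x + 2 * i) (fun x => by
      have := hup x
      simp only [abs_le]
      omega) hTi
    have hcol : ∀ j, lv j = i → ∀ y, d ≤ y → y ≤ Y →
        ReachIn (jumpGrid (fun j => (a j, b)) (fun j => (c j, d))) (T i ∪ C i ∪ R i)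
          (0, b - 2 * t + m 0 + 2 * i) (c j, y) := by
      intro j hj y h1 h2
      have hp : (a j, b) ∈ lane (fun x => b - 2 * t + m x + 2 * i) 0 X := by
        refine ⟨(ha j).1, (ha j).2, .inl ?_⟩
        have := hma' j
        rw [hj] at this
        simp only [this]
        ring
      refine (hlane _ hp).trans (ReachIn.trans (v := (c j, d)) ?_ (reachIn_col hH h1
        fun y' h3 h4 => .inl (.inr ⟨j, hj, rfl, h3, h4.trans h2⟩)))
      refine .single (jumpGrid_adj (fun j => (a j, b)) (fun j => (c j, d)) j ?_) (.inl (.inl hp))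
        (.inl (.inr ⟨j, hj, rfl, le_rfl, hdY⟩))
      intro h
      simp only [Prod.mk.injEq] at h
      rcases hown j with h' | h'
      · rw [h.1, sub_self, abs_zero] at h'
        omega
      · omega
    refine ConnIn.of_base (u := (0, b - 2 * t + m 0 + 2 * i)) (.inl (.inl ⟨le_rfl, hX, .inl rfl⟩)) ?_
    rintro ⟨x, y⟩ ((h | ⟨j, hj, h1, h2, h3⟩) | ⟨i', h1, h2, h3⟩)
    · exact hlane _ h
    · simp only at h1 h2 h3
      subst h1
      exact hcol j hj y h2 h3
    · simp only at h1 h2 h3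
      subst h3
      exact (hcol (i, i', false) rfl y hdY le_rfl).trans
        (reachIn_row hH h1 fun x' h4 h5 => .inr ⟨i', h4, by simp only; omega, rfl⟩)
  · intro i i' hii
    have hii' : (i : ℤ) ≠ i' := fun h => hii (Fin.ext (by exact_mod_cast h))
    have hTC : ∀ i k : Fin t, ∀ x y, (x, y) ∈ T i → (x, y) ∈ C k → False := by
      rintro i k x y ⟨h1, h2, h3⟩ ⟨j, -, h4, h5, h6⟩
      simp only at *
      subst h4
      have := hmc j
      have := hup (c j)
      have := hm2t (c j)
      have := hm2t (c j + 1)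
      have := hm0 (c j + 1)
      have := i.2
      omega
    have hTR : ∀ i k : Fin t, ∀ x y, (x, y) ∈ T i → (x, y) ∈ R k → False := by
      rintro i k x y ⟨h1, h2, h3⟩ ⟨j, h4, h5, h6⟩
      have := hm2t x
      have := hm2t (x + 1)
      have := hm0 x
      have := hm0 (x + 1)
      have := i.2
      simp only at *
      omega
    have hCR : ∀ i k : Fin t, i ≠ k → ∀ x y, (x, y) ∈ C i → (x, y) ∈ R k → False := by
      rintro i k hik x y ⟨j, hj, h1, -, -⟩ ⟨k', h2, h3, -⟩
      simp only at *
      subst h1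
      have := hcR j k k' h2 h3
      subst this
      exact hik hj.symm
    rw [Set.disjoint_left]
    rintro ⟨x, y⟩ ((h | h) | h) ((h' | h') | h')
    · obtain ⟨-, -, h⟩ := h
      obtain ⟨-, -, h'⟩ := h'
      have := hup x
      simp only at *
      omega
    · exact hTC _ _ _ _ h h'
    · exact hTR _ _ _ _ h h'
    · exact hTC _ _ _ _ h' h
    · obtain ⟨j, hj, h1, -⟩ := h
      obtain ⟨j', hj', h1', -⟩ := h'
      obtain rfl := hcinj j j' (h1.symm.trans h1')
      exact hii (hj.symm.trans hj')
    · exact hCR _ _ hii _ _ h h'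
    · exact hTR _ _ _ _ h' h
    · exact hCR _ _ hii.symm _ _ h' h
    · obtain ⟨j, h1, h2, -⟩ := h
      obtain ⟨j', h1', h2', -⟩ := h'
      have := hsep i j i' j' (by simp [hii])
      simp only at *
      omega
  · intro i i' hii
    have h := hlt i i'
    refine ⟨(c (i, i', true) - 1, Y), .inr ⟨i', by simp only; omega, by simp only; omega, rfl⟩,
      (c (i, i', true), Y), .inl (.inr ⟨(i, i', true), rfl, rfl, hdY, le_rfl⟩), ?_⟩
    have := grid_adj_right (c (i, i', true) - 1) Y
    rwa [sub_add_cancel] at this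

lemma grid_adj_reflect {Y : ℤ} {u v : ℤ × ℤ} (h : grid.Adj u v) :
    grid.Adj (u.1, Y - u.2) (v.1, Y - v.2) := by
  simp only [grid, SimpleGraph.fromRel_adj, ne_eq, Prod.ext_iff] at *
  omega

/-- Reflecting a grid model in a horizontal line. -/
lemma GridModel.reflect {κ : Type*} {t : ℕ} {X Y : ℤ} {p w : κ → ℤ × ℤ} {S : Fin t → Set (ℤ × ℤ)}
    (h : GridModel t (jumpGrid (fun k => ((p k).1, Y - (p k).2)) (fun k => ((w k).1, Y - (w k).2)))
      X Y S) :
    GridModel t (jumpGrid p w) X Y fun i => (fun u => (u.1, Y - u.2)) '' S i := by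
  have hinv : ∀ u : ℤ × ℤ, (u.1, Y - (Y - u.2)) = u := fun u => Prod.ext rfl (by simp)
  have hinj : Function.Injective fun u : ℤ × ℤ => (u.1, Y - u.2) := by
    intro u v h
    simp only [Prod.mk.injEq] at h
    exact Prod.ext h.1 (by omega)
  refine ⟨?_, ?_, ?_, ?_⟩
  · rintro i _ ⟨u, hu, rfl⟩
    have := h.subset i hu
    simp only [mem_rect] at *
    omega
  · intro i
    refine (h.conn i).image fun u _ v _ huv => ?_
    rcases huv with huv | ⟨hne, huv⟩
    · exact .inl (grid_adj_reflect huv)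
    · refine .inr ⟨fun h => hne (hinj h), ?_⟩
      rcases huv with ⟨k, rfl, rfl⟩ | ⟨k, rfl, rfl⟩
      · exact .inl ⟨k, hinv (p k), hinv (w k)⟩
      · exact .inr ⟨k, hinv (p k), hinv (w k)⟩
  · intro i j hij
    exact (Set.disjoint_image_iff hinj).2 (h.disjoint i j hij)
  · intro i j hij
    obtain ⟨u, hu, v, hv, huv⟩ := h.touch i j hij
    exact ⟨_, ⟨u, hu, rfl⟩, _, ⟨v, hv, rfl⟩, grid_adj_reflect huv⟩

lemma exists_gridModel_of_far {t : ℕ} (a c : Fin t × Fin t × Bool → ℤ) (b d X Y : ℤ)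
    (ha : ∀ j, 0 ≤ a j ∧ a j ≤ X) (hc : ∀ j, 0 ≤ c j ∧ c j ≤ X)
    (haa : ∀ j j', j ≠ j' → 2 * (t : ℤ) ≤ |a j - a j'|)
    (hca : ∀ j j', j ≠ j' → 2 * (t : ℤ) ≤ |c j - a j'|)
    (hown : (∀ j, 2 * (t : ℤ) ≤ |c j - a j|) ∨ 2 * t < |d - b|)
    (hd : 0 ≤ d) (hdY : d ≤ Y) (hb : 2 * (t : ℤ) < b) (hbY : b + 2 * t < Y)
    (hlt : ∀ i i', c (i, i', false) < c (i, i', true))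
    (hsep : ∀ i i' k k', (i, i') ≠ (k, k') → c (i, i', true) < c (k, k', false) ∨
      c (k, k', true) < c (i, i', false)) :
    ∃ S, GridModel t (jumpGrid (fun j => (a j, b)) (fun j => (c j, d))) X Y S := by
  rcases le_total b d with hbd | hbd
  · refine exists_gridModel_of_far_up a c b d X Y ha hc haa hca (fun j => ?_) hbd hdY hb.le hbY hlt
      hsep
    rw [abs_of_nonneg (by omega)] at hown
    exact hown.imp (fun h => h j) fun h => by omega
  · obtain ⟨S, hS⟩ := exists_gridModel_of_far_up a c (Y - b) (Y - d) X Y ha hc haa hca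
      (fun j => by
        rw [abs_of_nonpos (by omega)] at hown
        exact hown.imp (fun h => h j) fun h => by omega)
      (by omega) (by omega) (by omega) (by omega) hlt hsep
    exact ⟨_, GridModel.reflect (p := fun j => (a j, b)) (w := fun j => (c j, d)) hS⟩

/-- The permutation of the lanes effected by a word of transpositions. -/
def wordPerm {α : Type*} [DecidableEq α] : List (α × α) → Equiv.Perm α
  | [] => 1
  | k :: ks => wordPerm ks * Equiv.swap k.1 k.2

/-- Two items, starting at lanes `i` and `j`, get exchanged at some letter of the word. -/
def Meets {α : Type*} [DecidableEq α] : List (α × α) → α → α → Prop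
  | [], _, _ => False
  | k :: ks, i, j => (i = k.1 ∧ j = k.2 ∨ i = k.2 ∧ j = k.1) ∨
      Meets ks (Equiv.swap k.1 k.2 i) (Equiv.swap k.1 k.2 j)

lemma meets_append {α : Type*} [DecidableEq α] (ks ks' : List (α × α)) (i j : α) :
    Meets (ks ++ ks') i j ↔ Meets ks i j ∨ Meets ks' (wordPerm ks i) (wordPerm ks j) := by
  induction ks generalizing i j with
  | nil => simp [Meets, wordPerm]
  | cons k ks ih => simp only [List.cons_append, Meets, ih, wordPerm, Equiv.Perm.mul_apply, or_assoc]

lemma Meets.symm {α : Type*} [DecidableEq α] {ks : List (α × α)} {i j : α} (h : Meets ks i j) :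
    Meets ks j i := by
  induction ks generalizing i j with
  | nil => exact h
  | cons k ks ih => exact h.imp (fun h => h.symm.imp And.symm And.symm) ih

/-- Words in adjacent transpositions. -/
def IsAdjWord {t : ℕ} (ks : List (Fin t × Fin t)) : Prop :=
  ∀ k ∈ ks, (k.2 : ℕ) = k.1 + 1

lemma exists_meets_of_lt {t : ℕ} (n : ℕ) (i j : Fin t) (h : (j : ℕ) = i + 1 + n) :
    ∃ ks : List (Fin t × Fin t), IsAdjWord ks ∧ Meets ks i j := by
  induction n generalizing i with
  | zero => exact ⟨[(i, j)], by simpa [IsAdjWord] using h, .inl (.inl ⟨rfl, rfl⟩)⟩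
  | succ n ih =>
    have hi : (i : ℕ) + 1 < t := by omega
    obtain ⟨ks, hks, hm⟩ := ih ⟨i + 1, hi⟩ (by simp only; omega)
    refine ⟨(i, ⟨i + 1, hi⟩) :: ks, by simpa [IsAdjWord] using hks, .inr ?_⟩
    rwa [Equiv.swap_apply_left, Equiv.swap_apply_of_ne_of_ne]
    · rintro rfl
      omega
    · rintro rfl
      simp only at h
      omega

lemma exists_meets {t : ℕ} (i j : Fin t) (h : i ≠ j) :
    ∃ ks : List (Fin t × Fin t), IsAdjWord ks ∧ Meets ks i j := by
  rcases lt_or_gt_of_ne h with h | h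
  · exact exists_meets_of_lt (j - (i + 1)) i j (by omega)
  · obtain ⟨ks, hks, hm⟩ := exists_meets_of_lt (i - (j + 1)) j i (by omega)
    exact ⟨ks, hks, hm.symm⟩

/-- Some word in adjacent transpositions makes any two items meet. -/
lemma exists_word (t : ℕ) :
    ∃ ks : List (Fin t × Fin t), IsAdjWord ks ∧ ∀ i j, i ≠ j → Meets ks i j := by
  suffices h : ∀ A : Finset (Fin t × Fin t), ∃ ks : List (Fin t × Fin t), IsAdjWord ks ∧
      ∀ q ∈ A, q.1 ≠ q.2 → Meets ks q.1 q.2 by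
    obtain ⟨ks, hks, hm⟩ := h Finset.univ
    exact ⟨ks, hks, fun i j hij => hm (i, j) (Finset.mem_univ _) hij⟩
  intro A
  induction A using Finset.induction_on with
  | empty => exact ⟨[], by simp [IsAdjWord], by simp⟩
  | insert q A _ ih =>
    obtain ⟨ks, hks, hm⟩ := ih
    by_cases hq : q.1 = q.2
    · refine ⟨ks, hks, fun q' hq' hne => ?_⟩
      rcases Finset.mem_insert.1 hq' with rfl | h
      · exact absurd hq hne
      · exact hm _ h hne
    · obtain ⟨ks', hks', hm'⟩ := exists_meets (wordPerm ks q.1) (wordPerm ks q.2)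
        ((wordPerm ks).injective.ne hq)
      refine ⟨ks ++ ks', fun k hk => ?_, fun q' hq' hne => (meets_append _ _ _ _).2 ?_⟩
      · exact (List.mem_append.1 hk).elim (hks k) (hks' k)
      · rcases Finset.mem_insert.1 hq' with rfl | h
        · exact .inr hm'
        · exact .inl (hm _ h hne)

/-- Disjoint connected sets `P i` crossing the columns `[x₀, x₁]` of the plane, `P i` starting in
lane `i` and ending in lane `π i`, where `P i` and `P j` touch if `T i j`. The lane `i` is at
height `r + ρ i` on the left end and at height `r' + ρ i` on the right end. -/
structure Strip {t : ℕ} (H : SimpleGraph (ℤ × ℤ)) (Y : ℤ) (ρ : Fin t → ℤ) (x₀ x₁ r r' : ℤ)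
    (π : Equiv.Perm (Fin t)) (T : Fin t → Fin t → Prop) (P : Fin t → Set (ℤ × ℤ)) : Prop where
  subset : ∀ i, P i ⊆ rect x₀ x₁ 0 Y
  conn : ∀ i, ConnIn H (P i)
  disjoint : ∀ i j, i ≠ j → Disjoint (P i) (P j)
  left : ∀ i, (x₀, r + ρ i) ∈ P i
  right : ∀ i, (x₁, r' + ρ (π i)) ∈ P i
  touch : ∀ i j, T i j → ∃ u ∈ P i, ∃ v ∈ P j, grid.Adj u v

lemma ConnIn.union_adj {V : Type*} {G : SimpleGraph V} {S T : Set V} (hS : ConnIn G S)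
    (hT : ConnIn G T) {u v : V} (hu : u ∈ S) (hv : v ∈ T) (h : G.Adj u v) : ConnIn G (S ∪ T) := by
  refine .of_base (.inl hu) ?_
  rintro x (hx | hx)
  · exact (hS.2 u hu x hx).mono Set.subset_union_left
  · exact (ReachIn.single h (.inl hu) (.inr hv)).trans
      ((hT.2 v hv x hx).mono Set.subset_union_right)

lemma ConnIn.union {V : Type*} {G : SimpleGraph V} {S T : Set V} (hS : ConnIn G S)
    (hT : ConnIn G T) {u : V} (hu : u ∈ S) (hv : u ∈ T) : ConnIn G (S ∪ T) := by
  refine .of_base (.inl hu) ?_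
  rintro x (hx | hx)
  · exact (hS.2 u hu x hx).mono Set.subset_union_left
  · exact (hT.2 u hv x hx).mono Set.subset_union_right

section

variable {t : ℕ} {H : SimpleGraph (ℤ × ℤ)} {Y : ℤ} {ρ : Fin t → ℤ} {x₀ x₁ x₂ r r' r'' : ℤ}
  {π π' : Equiv.Perm (Fin t)} {T T' : Fin t → Fin t → Prop} {P P' : Fin t → Set (ℤ × ℤ)}

lemma Strip.append (hH : grid ≤ H) (h : Strip H Y ρ x₀ x₁ r r' π T P)
    (h' : Strip H Y ρ (x₁ + 1) x₂ r' r'' π' T' P') (h01 : x₀ ≤ x₁) (h12 : x₁ < x₂) :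
    Strip H Y ρ x₀ x₂ r r'' (π' * π) (fun i j => T i j ∨ T' (π i) (π j))
      fun i => P i ∪ P' (π i) where
  subset i := by
    rintro u (hu | hu)
    · have := h.subset i hu
      simp only [mem_rect] at *
      omega
    · have := h'.subset _ hu
      simp only [mem_rect] at *
      omega
  conn i := (h.conn i).union_adj (h'.conn _) (h.right i) (h'.left _) (hH (grid_adj_right _ _))
  disjoint i j hij := by
    have key : ∀ i j, Disjoint (P i) (P' j) := by
      intro i j
      rw [Set.disjoint_left]
      intro u hu hu'
      have h1 := h.subset i hu
      have h2 := h'.subset j hu'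
      simp only [mem_rect] at *
      omega
    simp only [Set.disjoint_union_left, Set.disjoint_union_right]
    exact ⟨⟨h.disjoint i j hij, (key _ _).symm⟩, key _ _, h'.disjoint _ _ (π.injective.ne hij)⟩
  left i := .inl (h.left i)
  right i := .inr (h'.right _)
  touch i j := by
    rintro (hT | hT)
    · obtain ⟨u, hu, v, hv, huv⟩ := h.touch i j hT
      exact ⟨u, .inl hu, v, .inl hv, huv⟩
    · obtain ⟨u, hu, v, hv, huv⟩ := h'.touch _ _ hT
      exact ⟨u, .inr hu, v, .inr hv, huv⟩

lemma Strip.mono (h : Strip H Y ρ x₀ x₁ r r' π T P) (hT : ∀ i j, T' i j → T i j) (hπ : π' = π) :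
    Strip H Y ρ x₀ x₁ r r' π' T' P :=
  ⟨h.subset, h.conn, h.disjoint, h.left, by rw [hπ]; exact h.right,
    fun i j hij => h.touch i j (hT i j hij)⟩

/-- Lanes moving simultaneously from level `r` to level `r'`. -/
lemma exists_strip_bend (hH : grid ≤ H) (hρ : ∀ i j, i < j → ρ i + 2 ≤ ρ j) (h01 : x₀ ≤ x₁)
    (hr : |r' - r| ≤ x₁ - x₀) (hY : ∀ i, 0 ≤ r + ρ i ∧ r + ρ i ≤ Y)
    (hY' : ∀ i, 0 ≤ r' + ρ i ∧ r' + ρ i ≤ Y) :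
    ∃ P, Strip H Y ρ x₀ x₁ r r' 1 (fun _ _ => False) P := by
  obtain ⟨f, hf0, hf1, hf, hfle⟩ : ∃ f : ℤ → ℤ, f x₀ = r ∧ f x₁ = r' ∧
      (∀ x, |f (x + 1) - f x| ≤ 1) ∧ ∀ x, x₀ ≤ x → min r r' ≤ f x ∧ f x ≤ max r r' := by
    rw [abs_le] at hr
    rcases le_total r r' with h | h
    · refine ⟨fun x => min r' (r + (x - x₀)), ?_, ?_, fun x => ?_, fun x hx => ?_⟩ <;>
        simp only [abs_le] <;> omega
    · refine ⟨fun x => max r' (r - (x - x₀)), ?_, ?_, fun x => ?_, fun x hx => ?_⟩ <;>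
        simp only [abs_le] <;> omega
  have hmem : ∀ i x, x₀ ≤ x → x ≤ x₁ → (x, f x + ρ i) ∈ lane (fun x => f x + ρ i) x₀ x₁ :=
    fun i x h1 h2 => ⟨h1, h2, .inl rfl⟩
  refine ⟨fun i => lane (fun x => f x + ρ i) x₀ x₁, ?_, fun i => ?_, ?_, fun i => ?_, fun i => ?_,
    by simp⟩
  · rintro i ⟨x, y⟩ ⟨h1, h2, h3⟩
    have := hfle x h1
    have := hfle (x + 1) (by simp only at *; omega)
    have := hY i
    have := hY' i
    simp only [mem_rect] at *
    omega
  · exact .of_base (hmem i x₀ le_rfl h01) (reachIn_lane hH (fun x => by simpa using hf x) le_rfl)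
  · intro i j hij
    rw [Set.disjoint_left]
    rintro ⟨x, y⟩ ⟨-, -, h⟩ ⟨-, -, h'⟩
    have h1 := hf x
    rw [abs_le] at h1
    simp only at *
    rcases lt_or_gt_of_ne hij with hij | hij
    · have := hρ _ _ hij
      omega
    · have := hρ _ _ hij
      omega
  · exact hf0 ▸ hmem i x₀ le_rfl h01
  · exact hf1 ▸ hmem i x₁ h01 le_rfl

end

/-- The lattice segment from `(a, y)` to `(b, y)`. -/
def hSeg (a b y : ℤ) : Set (ℤ × ℤ) := {p | min a b ≤ p.1 ∧ p.1 ≤ max a b ∧ p.2 = y}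

/-- The lattice segment from `(x, c)` to `(x, d)`. -/
def vSeg (x c d : ℤ) : Set (ℤ × ℤ) := {p | p.1 = x ∧ min c d ≤ p.2 ∧ p.2 ≤ max c d}

@[simp] lemma mem_hSeg {a b y x z : ℤ} :
    (x, z) ∈ hSeg a b y ↔ min a b ≤ x ∧ x ≤ max a b ∧ z = y := Iff.rfl

@[simp] lemma mem_vSeg {x c d y z : ℤ} :
    (y, z) ∈ vSeg x c d ↔ y = x ∧ min c d ≤ z ∧ z ≤ max c d := Iff.rfl

lemma connIn_hSeg {H : SimpleGraph (ℤ × ℤ)} (hH : grid ≤ H) (a b y : ℤ) :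
    ConnIn H (hSeg a b y) := by
  refine .of_base (u := (min a b, y)) (by simp) ?_
  rintro ⟨x, z⟩ h
  obtain ⟨h1, h2, rfl⟩ := mem_hSeg.1 h
  exact reachIn_row hH h1 fun x' h3 h4 => ⟨h3, h4.trans h2, rfl⟩

lemma connIn_vSeg {H : SimpleGraph (ℤ × ℤ)} (hH : grid ≤ H) (x c d : ℤ) :
    ConnIn H (vSeg x c d) := by
  refine .of_base (u := (x, min c d)) (by simp) ?_
  rintro ⟨z, y⟩ h
  obtain ⟨rfl, h1, h2⟩ := mem_vSeg.1 h
  exact reachIn_col hH h1 fun y' h3 h4 => ⟨rfl, h3, h4.trans h2⟩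

section

variable {t : ℕ} {H : SimpleGraph (ℤ × ℤ)} {Y s : ℤ} {ρ : Fin t → ℤ}

/-- Two sets exchanging adjacent lanes, together with straight lanes, form a strip. -/
lemma exists_strip_of_exchange (hH : grid ≤ H) {x₀ x₁ r b : ℤ}
    (hρ : ∀ i j, i < j → ρ i + s ≤ ρ j) (hs : 2 ≤ s) (h01 : x₀ ≤ x₁)
    {k k' : Fin t} (hk : (k' : ℕ) = k + 1) (hρk : ρ k' = ρ k + s) (hb : b = r + ρ k)
    (hsb : s ≤ b) (hY : ∀ i, 0 ≤ r + ρ i ∧ r + ρ i ≤ Y) {α β : Set (ℤ × ℤ)}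
    (hα : α ⊆ rect x₀ x₁ (b - s + 1) (b + s)) (hβ : β ⊆ rect x₀ x₁ (b - s + 1) (b + s))
    (hαc : ConnIn H α) (hβc : ConnIn H β) (hαβ : Disjoint α β)
    (hα0 : (x₀, b) ∈ α) (hα1 : (x₁, b + s) ∈ α) (hβ0 : (x₀, b + s) ∈ β) (hβ1 : (x₁, b) ∈ β)
    (hβ2 : (x₀, b + 1) ∈ β) :
    ∃ P, Strip H Y ρ x₀ x₁ r r (Equiv.swap k k') (Meets [(k, k')]) P := by
  have hkk : k ≠ k' := by
    rintro rfl
    omega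
  have hYk := hY k
  have hYk' := hY k'
  have hline : ∀ i, i ≠ k → i ≠ k' → ∀ u ∈ hSeg x₀ x₁ (r + ρ i), u ∉ rect x₀ x₁ (b - s + 1) (b + s) := by
    rintro i h1 h2 ⟨x, y⟩ h
    simp only [mem_hSeg] at h
    simp only [mem_rect]
    have h1' : (i : ℕ) ≠ k := fun h => h1 (Fin.ext h)
    have h2' : (i : ℕ) ≠ k' := fun h => h2 (Fin.ext h)
    rcases lt_or_gt_of_ne h1 with h3 | h3
    · have := hρ _ _ h3
      omega
    · have := hρ k' i (by rw [Fin.lt_def] at *; omega)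
      omega
  refine ⟨fun i => if i = k then α else if i = k' then β else hSeg x₀ x₁ (r + ρ i), ?_, ?_, ?_,
    ?_, ?_, ?_⟩
  · intro i
    split_ifs with h1 h2
    · rintro u hu
      have := hα hu
      simp only [mem_rect] at *
      omega
    · rintro u hu
      have := hβ hu
      simp only [mem_rect] at *
      omega
    · rintro ⟨x, y⟩ hu
      have := hY i
      simp only [mem_rect, mem_hSeg] at *
      omega
  · intro i
    split_ifs
    · exact hαc
    · exact hβc
    · exact connIn_hSeg hH _ _ _
  · intro i j hij
    have hd1 : ∀ i, i ≠ k → i ≠ k' → Disjoint α (hSeg x₀ x₁ (r + ρ i)) := fun i h1 h2 =>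
      Set.disjoint_left.2 fun u hu hu' => hline i h1 h2 u hu' (hα hu)
    have hd2 : ∀ i, i ≠ k → i ≠ k' → Disjoint β (hSeg x₀ x₁ (r + ρ i)) := fun i h1 h2 =>
      Set.disjoint_left.2 fun u hu hu' => hline i h1 h2 u hu' (hβ hu)
    have hd3 : Disjoint (hSeg x₀ x₁ (r + ρ i)) (hSeg x₀ x₁ (r + ρ j)) := by
      rw [Set.disjoint_left]
      rintro ⟨x, y⟩ hu hu'
      simp only [mem_hSeg] at *
      rcases lt_or_gt_of_ne hij with h | h
      · have := hρ _ _ h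
        omega
      · have := hρ _ _ h
        omega
    split_ifs with h1 h2 h3 h4 h5 h6 h7 h8
    · exact absurd (h1.trans h2.symm) hij
    · exact hαβ
    · exact hd1 j h2 h3
    · exact hαβ.symm
    · exact absurd (h4.trans h6.symm) hij
    · exact hd2 j h5 h6
    · exact (hd1 i h1 h4).symm
    · exact (hd2 i h1 h4).symm
    · exact hd3
  · intro i
    split_ifs with h1 h2
    · rwa [h1, ← hb]
    · rwa [h2, show r + ρ k' = b + s by omega]
    · simp [h01]
  · intro i
    split_ifs with h1 h2
    · rwa [h1, Equiv.swap_apply_left, show r + ρ k' = b + s by omega]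
    · rwa [h2, Equiv.swap_apply_right, ← hb]
    · rw [Equiv.swap_apply_of_ne_of_ne h1 h2]
      simp [h01]
  · rintro i j ((⟨rfl, rfl⟩ | ⟨rfl, rfl⟩) | h)
    · exact ⟨(x₀, b), by simpa using hα0, (x₀, b + 1), by simpa [hkk.symm] using hβ2,
        grid_adj_up _ _⟩
    · exact ⟨(x₀, b + 1), by simpa [hkk.symm] using hβ2, (x₀, b), by simpa using hα0,
        (grid_adj_up _ _).symm⟩
    · exact h.elim

/-- A virtual edge, or crossing virtual edges, allowing to exchange two lanes. -/
inductive IsGadget (H : SimpleGraph (ℤ × ℤ)) (L s a b : ℤ) : Prop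
  | jump (dx dy : ℤ) (hdx : |dx| ≤ L - 3) (hdy : |dy| ≤ s - 3) (hd : 2 ≤ dx ∨ |dx| ≤ 1 ∧ 2 ≤ dy)
      (h : H.Adj (a, b) (a + dx, b + dy)) : IsGadget H L s a b
  | cross (h : H.Adj (a, b) (a + 1, b + 1)) (h' : H.Adj (a, b + 1) (a + 1, b)) :
      IsGadget H L s a b

/-- The lane going up through the virtual edge. -/
def upTrack (L s a b dx dy : ℤ) : Set (ℤ × ℤ) :=
  hSeg (a - L) a b ∪ (hSeg (a + dx) (a + L - 1) (b + dy) ∪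
    (vSeg (a + L - 1) (b + dy) (b + s) ∪ hSeg (a + L - 1) (a + L) (b + s)))

lemma connIn_upTrack (hH : grid ≤ H) {L s a b dx dy : ℤ}
    (h : H.Adj (a, b) (a + dx, b + dy)) : ConnIn H (upTrack L s a b dx dy) := by
  refine (connIn_hSeg hH _ _ _).union_adj ((connIn_hSeg hH _ _ _).union
    ((connIn_vSeg hH _ _ _).union (connIn_hSeg hH _ _ _) (u := (a + L - 1, b + s)) ?_ ?_)
    (u := (a + L - 1, b + dy)) ?_ (.inl ?_)) (u := (a, b)) (v := (a + dx, b + dy)) ?_ (.inl ?_) h <;>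
    simp

/-- The lane going down from `(a - L, b + s)` to `(a + L, b)`, passing below the end of the virtual
edge. -/
def downTrack (L s a b dy : ℤ) : Set (ℤ × ℤ) :=
  vSeg (a - L) (b + 1) (b + s) ∪ (hSeg (a - L) (a + 1) (b + 1) ∪
    (vSeg (a + 1) (b + 1) (b + dy - 1) ∪ (hSeg (a + 1) (a + L) (b + dy - 1) ∪
      vSeg (a + L) (b + dy - 1) b)))

lemma connIn_downTrack (hH : grid ≤ H) (L s a b dy : ℤ) : ConnIn H (downTrack L s a b dy) := by
  refine (connIn_vSeg hH _ _ _).union ((connIn_hSeg hH _ _ _).union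
    ((connIn_vSeg hH _ _ _).union ((connIn_hSeg hH _ _ _).union (connIn_vSeg hH _ _ _)
      (u := (a + L, b + dy - 1)) ?_ ?_) (u := (a + 1, b + dy - 1)) ?_ (.inl ?_))
    (u := (a + 1, b + 1)) ?_ (.inl ?_)) (u := (a - L, b + 1)) ?_ (.inl ?_) <;>
    simp

/-- The lane going down from `(a - L, b + s)` to `(a + L, b)` through the virtual edge
from `(a, b + 1)` to `(a + 1, b)`. -/
def crossTrack (L s a b : ℤ) : Set (ℤ × ℤ) :=
  vSeg (a - L) (b + 1) (b + s) ∪ (hSeg (a - L) a (b + 1) ∪ hSeg (a + 1) (a + L) b)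

lemma connIn_crossTrack (hH : grid ≤ H) {L s a b : ℤ} (h : H.Adj (a, b + 1) (a + 1, b)) :
    ConnIn H (crossTrack L s a b) := by
  refine (connIn_vSeg hH _ _ _).union ((connIn_hSeg hH _ _ _).union_adj (connIn_hSeg hH _ _ _)
    (u := (a, b + 1)) (v := (a + 1, b)) ?_ ?_ h) (u := (a - L, b + 1)) ?_ (.inl ?_) <;>
    simp

lemma exists_tracks (hH : grid ≤ H) {L a b : ℤ} (hL : 4 ≤ L) (hs : 4 ≤ s)
    (h : IsGadget H L s a b) : ∃ α β : Set (ℤ × ℤ),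
      α ⊆ rect (a - L) (a + L) (b - s + 1) (b + s) ∧ β ⊆ rect (a - L) (a + L) (b - s + 1) (b + s) ∧
      ConnIn H α ∧ ConnIn H β ∧ Disjoint α β ∧ (a - L, b) ∈ α ∧ (a + L, b + s) ∈ α ∧
      (a - L, b + s) ∈ β ∧ (a + L, b) ∈ β ∧ (a - L, b + 1) ∈ β := by
  rcases h with ⟨dx, dy, hdx, hdy, hd | ⟨hd, hd'⟩, h⟩ | ⟨h, h'⟩
  · rw [abs_le] at hdx hdy
    refine ⟨upTrack L s a b dx dy, downTrack L s a b dy, ?_, ?_, connIn_upTrack hH h,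
      connIn_downTrack hH _ _ _ _ _, Set.disjoint_left.2 ?_, ?_⟩
    · rintro ⟨x, y⟩ (h | h | h | h) <;> simp only [mem_hSeg, mem_vSeg, mem_rect] at * <;> omega
    · rintro ⟨x, y⟩ (h | h | h | h | h) <;> simp only [mem_hSeg, mem_vSeg, mem_rect] at * <;> omega
    · rintro ⟨x, y⟩ (h | h | h | h) (h' | h' | h' | h' | h') <;>
        simp only [mem_hSeg, mem_vSeg] at * <;> omega
    · simp only [upTrack, downTrack, Set.mem_union, mem_hSeg, mem_vSeg, true_and, and_true]
      refine ⟨?_, ?_, ?_, ?_, ?_⟩ <;> omega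
  · rw [abs_le] at hdx hdy hd
    refine ⟨upTrack L s a b dx dy, downTrack L s a b 2, ?_, ?_, connIn_upTrack hH h,
      connIn_downTrack hH _ _ _ _ _, Set.disjoint_left.2 ?_, ?_⟩
    · rintro ⟨x, y⟩ (h | h | h | h) <;> simp only [mem_hSeg, mem_vSeg, mem_rect] at * <;> omega
    · rintro ⟨x, y⟩ (h | h | h | h | h) <;> simp only [mem_hSeg, mem_vSeg, mem_rect] at * <;> omega
    · rintro ⟨x, y⟩ (h | h | h | h) (h' | h' | h' | h' | h') <;>
        simp only [mem_hSeg, mem_vSeg] at * <;> omega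
    · simp only [upTrack, downTrack, Set.mem_union, mem_hSeg, mem_vSeg, true_and, and_true]
      refine ⟨?_, ?_, ?_, ?_, ?_⟩ <;> omega
  · refine ⟨upTrack L s a b 1 1, crossTrack L s a b, ?_, ?_, connIn_upTrack hH h,
      connIn_crossTrack hH h', Set.disjoint_left.2 ?_, ?_⟩
    · rintro ⟨x, y⟩ (h | h | h | h) <;> simp only [mem_hSeg, mem_vSeg, mem_rect] at * <;> omega
    · rintro ⟨x, y⟩ (h | h | h) <;> simp only [mem_hSeg, mem_vSeg, mem_rect] at * <;> omega
    · rintro ⟨x, y⟩ (h | h | h | h) (h' | h' | h') <;>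
        simp only [mem_hSeg, mem_vSeg] at * <;> omega
    · simp only [upTrack, crossTrack, Set.mem_union, mem_hSeg, mem_vSeg, true_and, and_true]
      refine ⟨?_, ?_, ?_, ?_, ?_⟩ <;> omega

/-- A strip exchanging two adjacent lanes at a gadget. -/
lemma exists_strip_of_isGadget (hH : grid ≤ H) {L R a b x₀ x₁ : ℤ} (hL : 4 ≤ L) (hs : 4 ≤ s)
    (hρ : ∀ i j, i < j → ρ i + s ≤ ρ j) (hρ0 : ∀ i, 0 ≤ ρ i ∧ ρ i + s ≤ R)
    {k k' : Fin t} (hk : (k' : ℕ) = k + 1) (hρk : ρ k' = ρ k + s)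
    (hb : R ≤ b) (hbY : b + R ≤ Y) (hx₀ : x₀ + L + R < a) (hx₁ : a + L + R < x₁)
    (h : IsGadget H L s a b) :
    ∃ P, Strip H Y ρ x₀ x₁ b b (Equiv.swap k k') (Meets [(k, k')]) P := by
  obtain ⟨α, β, hα, hβ, hαc, hβc, hαβ, hα0, hα1, hβ0, hβ1, hβ2⟩ := exists_tracks hH hL hs h
  have hY : ∀ i, 0 ≤ b + ρ i ∧ b + ρ i ≤ Y := fun i => by
    have := hρ0 i
    omega
  have hY' : ∀ i, 0 ≤ (b - ρ k) + ρ i ∧ (b - ρ k) + ρ i ≤ Y := fun i => by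
    have := hρ0 i
    have := hρ0 k
    omega
  have hρ2 : ∀ i j, i < j → ρ i + 2 ≤ ρ j := fun i j hij => by
    have := hρ i j hij
    omega
  have hk0 := hρ0 k
  obtain ⟨P₁, h₁⟩ := exists_strip_bend hH hρ2 (x₀ := x₀) (x₁ := a - L - 1) (r := b)
    (r' := b - ρ k) (by omega) (by rw [abs_le]; omega) hY hY'
  obtain ⟨P₂, h₂⟩ := exists_strip_of_exchange hH (Y := Y) (x₀ := a - L) (x₁ := a + L)
    (r := b - ρ k) (b := b) hρ (by omega) (by omega) hk hρk (by omega) (by omega) hY' hα hβ hαc hβc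
    hαβ hα0 hα1 hβ0 hβ1 hβ2
  obtain ⟨P₃, h₃⟩ := exists_strip_bend hH hρ2 (x₀ := a + L + 1) (x₁ := x₁) (r := b - ρ k)
    (r' := b) (by omega) (by rw [abs_le]; omega) hY' hY
  rw [show a - L = a - L - 1 + 1 by ring] at h₂
  exact ⟨_, ((h₁.append hH h₂ (by omega) (by omega)).append hH h₃ (by omega) (by omega)).mono
    (fun i j h => .inl (.inr h)) (by simp)⟩

lemma exists_strip_of_word (hH : grid ≤ H) {L R b : ℤ} (hL : 4 ≤ L) (hs : 4 ≤ s)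
    (hρ : ∀ i j, i < j → ρ i + s ≤ ρ j) (hρ0 : ∀ i, 0 ≤ ρ i ∧ ρ i + s ≤ R)
    (hρs : ∀ i j : Fin t, (j : ℕ) = i + 1 → ρ j = ρ i + s) (hR : 0 ≤ R)
    (hb : R ≤ b) (hbY : b + R ≤ Y) (ks : List (Fin t × Fin t)) (hks : IsAdjWord ks) (a : ℕ → ℤ)
    (x₀ x₁ : ℤ) (hx₀ : ∀ j < ks.length, x₀ + L + R < a j)
    (ha : ∀ i j, i < j → j < ks.length → a i + 2 * L + 2 * R + 2 < a j)
    (hx₁ : ∀ j < ks.length, a j + L + R + 1 < x₁) (h01 : x₀ ≤ x₁)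
    (h : ∀ j < ks.length, IsGadget H L s (a j) b) :
    ∃ P, Strip H Y ρ x₀ x₁ b b (wordPerm ks) (Meets ks) P := by
  induction ks generalizing a x₀ with
  | nil =>
    have hY : ∀ i, 0 ≤ b + ρ i ∧ b + ρ i ≤ Y := fun i => by
      have := hρ0 i
      omega
    obtain ⟨P, hP⟩ := exists_strip_bend hH (fun i j hij => by
      have := hρ i j hij
      omega) h01 (r := b) (r' := b) (by simpa using h01) hY hY
    exact ⟨P, hP.mono (fun _ _ h => h) rfl⟩
  | cons k ks ih =>
    have h0 : 0 < (k :: ks).length := by simp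
    have hk := hks k (by simp)
    obtain ⟨P, hP⟩ := exists_strip_of_isGadget hH (Y := Y) (x₀ := x₀) (x₁ := a 0 + L + R + 1) hL hs
      hρ hρ0 hk (hρs _ _ hk) hb hbY (hx₀ 0 h0) (by omega) (h 0 h0)
    obtain ⟨P', hP'⟩ := ih (fun k hk => hks k (by simp [hk])) (fun j => a (j + 1))
      (a 0 + L + R + 1 + 1)
      (fun j hj => by
        have := ha 0 (j + 1) (by omega) (by simpa using hj)
        omega)
      (fun i j hij hj => ha (i + 1) (j + 1) (by omega) (by simpa using hj))
      (fun j hj => hx₁ (j + 1) (by simpa using hj))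
      (by have := hx₁ 0 h0; omega) (fun j hj => h (j + 1) (by simpa using hj))
    have hlast : a 0 + L + R + 1 < x₁ := hx₁ 0 h0
    refine ⟨_, (hP.append hH hP' (by have := hx₀ 0 h0; omega) hlast).mono (fun i j hij => ?_) rfl⟩
    exact hij.imp_left .inl

/-- Sufficiently many gadgets in one row produce a grid model of `K_t`. -/
theorem exists_gridModel_of_isGadget (hH : grid ≤ H) {L R b X : ℤ} (hL : 4 ≤ L) (hs : 4 ≤ s)
    (hR : s * t = R) (hb : R ≤ b) (hbY : b + R ≤ Y) {ks : List (Fin t × Fin t)}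
    (hks : IsAdjWord ks) (hm : ∀ i j, i ≠ j → Meets ks i j) (a : ℕ → ℤ)
    (hx₀ : ∀ j < ks.length, L + R < a j)
    (ha : ∀ i j, i < j → j < ks.length → a i + 2 * L + 2 * R + 2 < a j)
    (hx₁ : ∀ j < ks.length, a j + L + R + 1 < X) (hX : 0 ≤ X)
    (h : ∀ j < ks.length, IsGadget H L s (a j) b) : ∃ S, GridModel t H X Y S := by
  have hR0 : 0 ≤ R := hR ▸ by positivity
  obtain ⟨P, hP⟩ := exists_strip_of_word (Y := Y) (ρ := fun i => s * (i : ℕ)) hH hL hs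
    (fun i j hij => by
      have : (i : ℤ) + 1 ≤ j := by exact_mod_cast hij
      nlinarith)
    (fun i => ⟨by positivity, by
      have : (i : ℤ) + 1 ≤ t := by exact_mod_cast i.2
      nlinarith⟩)
    (fun i j hij => by
      rw [hij]
      push_cast
      ring) hR0 hb hbY ks hks a 0 X (fun j hj => by simpa using hx₀ j hj) ha hx₁ hX h
  exact ⟨P, hP.subset, hP.conn, hP.disjoint, fun i j hij => hP.touch i j (hm i j hij)⟩

end

/-- A family of objects with labels in a finite set contains a large subfamily with constant
label. -/
lemma exists_monochromatic {ι κ : Type*} (K : Finset κ) (m : ℕ) (I : Finset ι)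
    (hI : K.card * m < I.card) (P : κ → ι → Prop) (h : ∀ i ∈ I, ∃ k ∈ K, P k i) :
    ∃ k ∈ K, ∃ I' ⊆ I, m ≤ I'.card ∧ ∀ i ∈ I', P k i := by
  classical
  have : ∀ i, ∃ k, i ∈ I → k ∈ K ∧ P k i := fun i => by
    by_cases hi : i ∈ I
    · obtain ⟨k, hk, hP⟩ := h i hi
      exact ⟨k, fun _ => ⟨hk, hP⟩⟩
    · obtain ⟨i₀, hi₀⟩ := Finset.card_pos.1 (Nat.zero_lt_of_lt hI)
      exact ⟨(h i₀ hi₀).choose, fun h => absurd h hi⟩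
  choose f hf using this
  obtain ⟨k, hk, hm⟩ := Finset.exists_lt_card_fiber_of_mul_lt_card_of_maps_to
    (fun i hi => (hf i hi).1) hI
  refine ⟨k, hk, I.filter fun i => f i = k, Finset.filter_subset _ _, hm.le, fun i hi => ?_⟩
  have hi' := Finset.mem_filter.1 hi
  exact hi'.2 ▸ (hf i hi'.1).2

/-- A partial function has large independent sets. -/
lemma exists_independent {ι : Type*} (B : ι → ι → Prop) (hB : ∀ i j k, B i j → B i k → j = k)
    (m : ℕ) (I : Finset ι) (hI : 3 * m ≤ I.card) :
    ∃ I' ⊆ I, m ≤ I'.card ∧ ∀ i ∈ I', ∀ j ∈ I', i ≠ j → ¬ B i j := by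
  classical
  induction m generalizing I with
  | zero => exact ⟨∅, by simp, by simp, by simp⟩
  | succ m ih =>
    have hout : ∀ v, (I.filter fun u => B v u).card ≤ 1 := fun v =>
      Finset.card_le_one.2 fun a ha b hb =>
        hB v a b (Finset.mem_filter.1 ha).2 (Finset.mem_filter.1 hb).2
    obtain ⟨v, hv, hin⟩ : ∃ v ∈ I, (I.filter fun u => B u v).card ≤ 1 := by
      by_contra! h
      have := Finset.card_mul_le_card_mul (s := I) (t := I) (fun a b => B b a) (m := 2) (n := 1)
        (fun a ha => h a ha) (fun b _ => hout b)
      omega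
    obtain ⟨I₁, hI₁⟩ : ∃ I₁, I₁ = I \ ({v} ∪ (I.filter fun u => B u v) ∪ I.filter fun u => B v u) := ⟨_, rfl⟩
    obtain ⟨I', hI', hcard, hind⟩ := ih I₁ (by
      have h1 := Finset.le_card_sdiff
        ({v} ∪ (I.filter fun u => B u v) ∪ I.filter fun u => B v u) I
      have h2 := Finset.card_union_le ({v} ∪ I.filter fun u => B u v) (I.filter fun u => B v u)
      have h3 := Finset.card_union_le {v} (I.filter fun u => B u v)
      have h4 := hout v
      rw [Finset.card_singleton] at h3
      rw [← hI₁] at h1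
      omega)
    have hI'1 : ∀ u ∈ I', u ∈ I ∧ u ≠ v ∧ ¬ B u v ∧ ¬ B v u := by
      intro u hu
      have := hI' hu
      simp only [hI₁, Finset.mem_sdiff, Finset.mem_union, Finset.mem_singleton,
        Finset.mem_filter] at this
      tauto
    refine ⟨insert v I', ?_, ?_, ?_⟩
    · exact Finset.insert_subset hv fun u hu => (hI'1 u hu).1
    · rw [Finset.card_insert_of_notMem fun h => (hI'1 v h).2.1 rfl]
      omega
    · intro i hi j hj hij
      rcases Finset.mem_insert.1 hi with hi | hi <;> rcases Finset.mem_insert.1 hj with hj | hj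
      · exact absurd (hi.trans hj.symm) hij
      · exact hi ▸ (hI'1 j hj).2.2.2
      · exact hj ▸ (hI'1 i hi).2.2.1
      · exact hind i hi j hj hij

/-- Enumerating a finite family by increasing values of an injective function. -/
lemma exists_strictMono_comp {ι α : Type*} [LinearOrder α] (I : Finset ι) (f : ι → α)
    (hf : Set.InjOn f I) {n : ℕ} (hn : n ≤ I.card) :
    ∃ e : Fin n → ι, (∀ k, e k ∈ I) ∧ StrictMono (f ∘ e) := by
  classical
  have hn' : n ≤ (I.image f).card := by rwa [Finset.card_image_of_injOn hf]
  have : ∀ k, ∃ i ∈ I, f i = (I.image f).orderEmbOfCardLe hn' k := fun k =>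
    Finset.mem_image.1 (Finset.orderEmbOfCardLe_mem _ _ k)
  choose e he hfe using this
  refine ⟨e, he, fun k k' h => ?_⟩
  simpa [hfe] using h

/-- Far spread intervals `[l i, r i]` inside `[0, X]`. -/
structure Gaps (ℓ X : ℤ) (W : ℕ) (l r : ℕ → ℤ) : Prop where
  left : ∀ i, ℓ ≤ l i
  sep : ∀ i j, i < j → r i + ℓ ≤ l j
  right : ∀ i < W, r i + ℓ ≤ X

lemma Gaps.le_of_ne {ℓ X : ℤ} {W : ℕ} {l r : ℕ → ℤ} (h : Gaps ℓ X W l r) {i j : ℕ}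
    (hij : i ≠ j) : r i + ℓ ≤ l j ∨ r j + ℓ ≤ l i :=
  (lt_or_gt_of_ne hij).imp (h.sep i j) (h.sep j i)

section

variable {V : Type*} {G : SimpleGraph V} {ψ ψ' : ℤ × ℤ → V} {D : ℤ → ℤ → Bool} {X Y ℓ : ℤ}
  {W t : ℕ} {l r : ℕ → ℤ}

lemma jumpSystem_of_isJump (hψ' : Set.InjOn ψ' (rect 0 X 0 Y)) (hℓ : 0 < ℓ)
    (hg : Gaps ℓ X W l r) {n : ℕ} {e : Fin n → ℕ} (he : ∀ k, e k < W)
    (hinj : Function.Injective e) {p w : Fin n → ℤ × ℤ} {J : Fin n → Set V}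
    (h : ∀ k, IsJump G ψ ψ' X Y (l (e k)) (r (e k)) (p k) (w k) (J k)) :
    JumpSystem G X Y ψ p w J where
  left_image k := (h k).left_image
  right_image k := (h k).right_image
  conn k := (h k).conn
  eq_or_eq k := (h k).eq_or_eq
  disjoint k k' hk := by
    rw [Set.disjoint_left]
    intro x hx hx'
    obtain ⟨u, hu, rfl⟩ := (h k).subset hx
    obtain ⟨v, hv, huv⟩ := (h k').subset hx'
    have h1 := hg.le_of_ne (hinj.ne hk)
    have h2 := hg.left (e k)
    have h3 := hg.left (e k')
    have h4 := hg.right _ (he k)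
    have h5 := hg.right _ (he k')
    have : v = u := hψ' (by simp only [mem_rect] at *; omega) (by simp only [mem_rect] at *; omega)
      huv
    subst this
    simp only [mem_rect] at *
    omega

/-- Jumps with equal rows of both ends that are long, or that move by many rows, yield a `K_t`
minor. -/
lemma hasMinor_of_far (hψ : BoxHom G D X Y ψ) (hψ' : Set.InjOn ψ' (rect 0 X 0 Y))
    (hg : Gaps ℓ X W l r) (hℓ : 4 * (t : ℤ) + 2 ≤ ℓ) {I : Finset ℕ} (hI : ∀ i ∈ I, i < W)
    (hcard : 3 * (t * t * 2) ≤ I.card) {b d : ℤ} (hb : 2 * (t : ℤ) < b) (hbY : b + 2 * t < Y)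
    (h : ∀ i ∈ I, ∃ a c J, IsJump G ψ ψ' X Y (l i) (r i) (a, b) (c, d) J ∧ l i - 1 ≤ a ∧ a ≤ r i ∧
      (2 * (t : ℤ) < |c - a| ∨ 2 * (t : ℤ) < |d - b|)) :
    G.HasMinor (⊤ : SimpleGraph (Fin t)) := by
  have : ∀ i, ∃ a c : ℤ, ∃ J : Set V, i ∈ I → IsJump G ψ ψ' X Y (l i) (r i) (a, b) (c, d) J ∧
      l i - 1 ≤ a ∧ a ≤ r i ∧ (2 * (t : ℤ) < |c - a| ∨ 2 * (t : ℤ) < |d - b|) := fun i => by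
    by_cases hi : i ∈ I
    · obtain ⟨a, c, J, hJ⟩ := h i hi
      exact ⟨a, c, J, fun _ => hJ⟩
    · exact ⟨0, 0, ∅, fun h => absurd h hi⟩
  choose a c J hJ using this
  have hsep : ∀ i ∈ I, ∀ j ∈ I, i ≠ j → 4 * (t : ℤ) ≤ |a i - a j| := by
    intro i hi j hj hij
    have h1 := hJ i hi
    have h2 := hJ j hj
    rw [le_abs]
    rcases hg.le_of_ne hij with h3 | h3 <;> omega
  obtain ⟨I₁, hI₁, hcard₁, hind⟩ := exists_independent
    (fun i j => i ∈ I ∧ j ∈ I ∧ |c i - a j| < 2 * (t : ℤ)) (fun i j k hj hk => by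
      by_contra hjk
      have h1 := hsep j hj.2.1 k hk.2.1 hjk
      have h2 := abs_sub_le (a j) (c i) (a k)
      rw [abs_sub_comm (a j) (c i)] at h2
      have := hj.2.2
      have := hk.2.2
      omega) _ I hcard
  have hJ₁ := fun i (hi : i ∈ I₁) => hJ i (hI₁ hi)
  have hcinj : Set.InjOn c I₁ := by
    intro i hi j hj hij
    by_contra hne
    have hsys := jumpSystem_of_isJump hψ' (by omega) hg (n := 2) (e := ![i, j])
      (p := ![(a i, b), (a j, b)]) (w := ![(c i, d), (c j, d)]) (J := ![J i, J j])
      (fun k => by fin_cases k <;> simp [hI i (hI₁ hi), hI j (hI₁ hj)])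
      (by
        intro k k' hk
        fin_cases k <;> fin_cases k' <;> simp_all)
      (fun k => by
        fin_cases k
        · exact (hJ₁ i hi).1
        · exact (hJ₁ j hj).1)
    refine Set.disjoint_left.1 (hsys.disjoint 0 1 (by simp)) (hsys.right_image 0) ?_
    have := hsys.right_image 1
    simpa [hij] using this
  obtain ⟨e, he, hmono⟩ := exists_strictMono_comp I₁ c hcinj hcard₁
  let idx : Fin t × Fin t × Bool → Fin (t * t * 2) := fun j =>
    finProdFinEquiv (finProdFinEquiv (j.1, j.2.1), if j.2.2 then 1 else 0)
  have hidx : ∀ i i' x, (idx (i, i', x) : ℕ) =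
      2 * (finProdFinEquiv (i, i') : Fin (t * t)) + if x then 1 else 0 := by
    intro i i' x
    simp only [idx, finProdFinEquiv_apply_val]
    split_ifs <;> simp [mul_comm, add_comm]
  have hlt : ∀ k k' : Fin (t * t * 2), (k : ℕ) < k' → c (e k) < c (e k') := fun k k' h => hmono h
  have hinj : ∀ j j', j ≠ j' → e (idx j) ≠ e (idx j') := by
    intro j j' hj h
    have h1 : idx j = idx j' := hmono.injective (by simp [h])
    refine hj ?_
    have h2 := finProdFinEquiv.injective h1
    simp only [Prod.mk.injEq, EmbeddingLike.apply_eq_iff_eq] at h2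
    rcases j with ⟨i, i', x⟩
    rcases j' with ⟨k, k', x'⟩
    cases x <;> cases x' <;> simp_all
  have he' : ∀ k, e k ∈ I := fun k => hI₁ (he k)
  have hbox : ∀ j, (a j, b) ∈ rect 0 X 0 Y → (c j, d) ∈ rect 0 X 0 Y →
      (0 ≤ a j ∧ a j ≤ X) ∧ (0 ≤ c j ∧ c j ≤ X) ∧ 0 ≤ d ∧ d ≤ Y := by
    intro j h1 h2
    simp only [mem_rect] at *
    omega
  have hbox' : ∀ k, (0 ≤ a (e k) ∧ a (e k) ≤ X) ∧ (0 ≤ c (e k) ∧ c (e k) ≤ X) ∧ 0 ≤ d ∧ d ≤ Y :=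
    fun k => hbox _ (hJ₁ _ (he k)).1.left_mem (hJ₁ _ (he k)).1.right_mem
  rcases Nat.eq_zero_or_pos t with rfl | ht
  · exact hasMinor_top_of_connIn (fun i => i.elim0) (fun i => i.elim0) (fun i => i.elim0)
      (fun i => i.elim0)
  have hd := (hbox' (idx (⟨0, ht⟩, ⟨0, ht⟩, true))).2.2
  obtain ⟨S, hS⟩ := exists_gridModel_of_far (fun j => a (e (idx j))) (fun j => c (e (idx j))) b d X Y
    (fun j => (hbox' _).1) (fun j => (hbox' _).2.1)
    (fun j j' hj => by
      have := hsep _ (he' (idx j)) _ (he' (idx j')) (hinj j j' hj)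
      omega)
    (fun j j' hj => by
      have := hind _ (he (idx j)) _ (he (idx j')) (hinj j j' hj)
      simp only [he', true_and, not_lt] at this
      exact this)
    (by
      by_cases hbd : 2 * (t : ℤ) < |d - b|
      · exact .inr hbd
      · exact .inl fun j => ((hJ₁ _ (he (idx j))).2.2.2.resolve_right hbd).le)
    hd.1 hd.2 hb hbY
    (fun i i' => hlt _ _ (by simp [hidx]))
    (fun i i' k k' hne => by
      have : (finProdFinEquiv (i, i') : ℕ) ≠ finProdFinEquiv (k, k') := fun h =>
        hne (finProdFinEquiv.injective (Fin.ext h))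
      rcases lt_or_gt_of_ne this with h | h
      · exact .inl (hlt _ _ (by
          rw [hidx, hidx]
          simp only [if_true, Bool.false_eq_true, if_false]
          omega))
      · exact .inr (hlt _ _ (by
          rw [hidx, hidx]
          simp only [if_true, Bool.false_eq_true, if_false]
          omega)))
  have hsys := jumpSystem_of_isJump hψ' (by omega) hg (fun k => hI _ (he' k))
    (fun k k' h => hmono.injective (by simp [h])) (fun k => (hJ₁ _ (he k)).1)
  have hinjidx : Function.Injective idx := fun j j' h => by
    by_contra hne
    exact hinj j j' hne (by rw [h])
  refine JumpSystem.hasMinor (J := fun j => J (e (idx j))) ⟨fun j => hsys.left_image _,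
    fun j => hsys.right_image _, fun j => hsys.conn _, fun j => hsys.eq_or_eq _,
    fun j j' hj => hsys.disjoint _ _ (hinjidx.ne hj)⟩ hψ hS

end

section

variable {V : Type*} {G : SimpleGraph V} {ψ ψ' : ℤ × ℤ → V} {D : ℤ → ℤ → Bool} {X Y ℓ R b : ℤ}
  {W t : ℕ} {l r : ℕ → ℤ} {ks : List (Fin t × Fin t)}

lemma IsJump.swap {l r : ℤ} {p w : ℤ × ℤ} {J : Set V} (h : IsJump G ψ ψ' X Y l r p w J) :
    IsJump G ψ ψ' X Y l r w p J :=
  ⟨h.right_mem, h.left_mem, h.right_image, h.left_image, h.conn, h.subset,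
    fun z hz hzJ => (h.eq_or_eq z hz hzJ).symm⟩

lemma exists_gridModel_of_gaps {H : SimpleGraph (ℤ × ℤ)} (hH : grid ≤ H) (hX : 0 ≤ X)
    (hg : Gaps ℓ X W l r) (hR : (2 * t + 4) * t = R) (hℓ : 8 * (t : ℤ) + 2 * R + 20 ≤ ℓ)
    (hb : R ≤ b) (hbY : b + R ≤ Y) (hks : IsAdjWord ks) (hm : ∀ i j, i ≠ j → Meets ks i j)
    {e : Fin ks.length → ℕ} (he : ∀ k, e k < W) (hmono : StrictMono e) (a : Fin ks.length → ℤ)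
    (ha : ∀ k, l (e k) - 1 - 2 * t ≤ a k ∧ a k ≤ r (e k) + 2 * t)
    (h : ∀ k, IsGadget H (2 * t + 4) (2 * t + 4) (a k) b) : ∃ S, GridModel t H X Y S := by
  have hR0 : 0 ≤ R := hR ▸ by positivity
  obtain ⟨a', ha'⟩ : ∃ a' : ℕ → ℤ, ∀ k : Fin ks.length, a' k = a k :=
    ⟨fun j => if hj : j < ks.length then a ⟨j, hj⟩ else 0, fun k => by simp⟩
  have hbd : ∀ (j) (hj : j < ks.length), l (e ⟨j, hj⟩) - 1 - 2 * t ≤ a' j ∧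
      a' j ≤ r (e ⟨j, hj⟩) + 2 * t := fun j hj => by
    have := ha' ⟨j, hj⟩
    simp only at this
    exact this ▸ ha _
  refine exists_gridModel_of_isGadget hH (L := 2 * t + 4) (s := 2 * t + 4) (by omega) (by omega) hR
    hb hbY hks hm a' (fun j hj => ?_) (fun i j hij hj => ?_) (fun j hj => ?_) hX (fun j hj => ?_)
  · have := hbd j hj
    have := hg.left (e ⟨j, hj⟩)
    omega
  · have := hbd j hj
    have := hbd i (hij.trans hj)
    have := hg.sep _ _ (hmono (show (⟨i, hij.trans hj⟩ : Fin _) < ⟨j, hj⟩ from hij))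
    omega
  · have := hbd j hj
    have := hg.right _ (he ⟨j, hj⟩)
    omega
  · have := h ⟨j, hj⟩
    rwa [← ha'] at this

/-- Short jumps with equal displacement yield a `K_t` minor. -/
lemma hasMinor_of_oriented (hψ : BoxHom G D X Y ψ) (hψ' : Set.InjOn ψ' (rect 0 X 0 Y))
    (hX : 0 ≤ X) (hg : Gaps ℓ X W l r) (hR : (2 * t + 4) * t = R)
    (hℓ : 8 * (t : ℤ) + 2 * R + 20 ≤ ℓ) (hb : R ≤ b) (hbY : b + R ≤ Y) (hks : IsAdjWord ks)
    (hm : ∀ i j, i ≠ j → Meets ks i j) {I : Finset ℕ} (hI : ∀ i ∈ I, i < W)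
    (hcard : ks.length ≤ I.card) {dx dy : ℤ} (hdx : |dx| ≤ 2 * t) (hdy : |dy| ≤ 2 * t)
    (hd : 2 ≤ dx ∨ |dx| ≤ 1 ∧ 2 ≤ dy)
    (h : ∀ i ∈ I, ∃ a J, IsJump G ψ ψ' X Y (l i) (r i) (a, b) (a + dx, b + dy) J ∧
      l i - 1 - 2 * t ≤ a ∧ a ≤ r i + 2 * t) :
    G.HasMinor (⊤ : SimpleGraph (Fin t)) := by
  have hR0 : 0 ≤ R := hR ▸ by positivity
  obtain ⟨e, he, hmono⟩ := exists_strictMono_comp I id Function.injective_id.injOn hcard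
  choose a J hJ hal har using fun k => h (e k) (he k)
  have hsys := jumpSystem_of_isJump hψ' (by omega) hg (fun k => hI _ (he k))
    hmono.injective.of_comp hJ
  obtain ⟨S, hS⟩ := exists_gridModel_of_gaps
    (H := jumpGrid (fun k => (a k, b)) fun k => (a k + dx, b + dy)) (grid_le_jumpGrid _ _) hX hg hR
    hℓ hb hbY hks hm (fun k => hI _ (he k)) hmono a (fun k => ⟨hal k, har k⟩) fun k => by
      refine .jump dx dy (by omega) (by omega) hd
        (jumpGrid_adj (fun k => (a k, b)) (fun k => (a k + dx, b + dy)) k fun h => ?_)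
      simp only [Prod.mk.injEq] at h
      omega
  exact hsys.hasMinor hψ hS

lemma hasMinor_of_short (hψ : BoxHom G D X Y ψ) (hψ' : Set.InjOn ψ' (rect 0 X 0 Y))
    (hX : 0 ≤ X) (hg : Gaps ℓ X W l r) (hR : (2 * t + 4) * t = R)
    (hℓ : 8 * (t : ℤ) + 2 * R + 20 ≤ ℓ) (hb : R + 2 * t ≤ b) (hbY : b + R + 2 * t ≤ Y)
    (hks : IsAdjWord ks) (hm : ∀ i j, i ≠ j → Meets ks i j) {I : Finset ℕ} (hI : ∀ i ∈ I, i < W)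
    (hcard : ks.length ≤ I.card) {dx dy : ℤ} (hdx : |dx| ≤ 2 * t) (hdy : |dy| ≤ 2 * t)
    (hd : ¬ (|dx| ≤ 1 ∧ |dy| ≤ 1))
    (h : ∀ i ∈ I, ∃ a J, IsJump G ψ ψ' X Y (l i) (r i) (a, b) (a + dx, b + dy) J ∧
      l i - 1 ≤ a ∧ a ≤ r i) :
    G.HasMinor (⊤ : SimpleGraph (Fin t)) := by
  have hdx' := abs_le.1 hdx
  have hdy' := abs_le.1 hdy
  by_cases ho : 2 ≤ dx ∨ |dx| ≤ 1 ∧ 2 ≤ dy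
  · refine hasMinor_of_oriented (b := b) (dx := dx) (dy := dy) hψ hψ' hX hg hR hℓ (by omega) (by omega) hks hm hI hcard hdx hdy ho
      fun i hi => ?_
    obtain ⟨a, J, hJ, h1, h2⟩ := h i hi
    exact ⟨a, J, hJ, by omega, by omega⟩
  · refine hasMinor_of_oriented (b := b + dy) (dx := -dx) (dy := -dy) hψ hψ' hX hg hR hℓ (by omega)
      (by omega) hks hm hI hcard (by rwa [abs_neg]) (by rwa [abs_neg]) ?_ fun i hi => ?_
    · rw [abs_neg]
      rw [abs_le, abs_le] at hd
      rw [abs_le] at ho ⊢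
      omega
    · obtain ⟨a, J, hJ, h1, h2⟩ := h i hi
      refine ⟨a + dx, J, ?_, by omega, by omega⟩
      simpa using hJ.swap

/-- Cells with two diagonals yield a `K_t` minor. -/
lemma hasMinor_of_cross (hψ : BoxHom G D X Y ψ)
    (hX : 0 ≤ X) (hg : Gaps ℓ X W l r) (hR : (2 * t + 4) * t = R)
    (hℓ : 8 * (t : ℤ) + 2 * R + 20 ≤ ℓ) (hb : R ≤ b) (hbY : b + R ≤ Y) (hbY' : b < Y)
    (hks : IsAdjWord ks) (hm : ∀ i j, i ≠ j → Meets ks i j) {I : Finset ℕ} (hI : ∀ i ∈ I, i < W)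
    (hcard : ks.length ≤ I.card)
    (h : ∀ i ∈ I, ∃ x, l i ≤ x ∧ x < r i ∧ G.Adj (ψ (x, b)) (ψ (x + 1, b + 1)) ∧
      G.Adj (ψ (x, b + 1)) (ψ (x + 1, b))) :
    G.HasMinor (⊤ : SimpleGraph (Fin t)) := by
  have hR0 : 0 ≤ R := hR ▸ by positivity
  obtain ⟨e, he, hmono⟩ := exists_strictMono_comp I id Function.injective_id.injOn hcard
  choose a hal har hasc hdesc using fun k => h (e k) (he k)
  obtain ⟨p, hp⟩ : ∃ p : Fin ks.length × Bool → ℤ × ℤ,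
      p = fun k => (a k.1, if k.2 then b + 1 else b) := ⟨_, rfl⟩
  obtain ⟨w, hw⟩ : ∃ w : Fin ks.length × Bool → ℤ × ℤ,
      w = fun k => (a k.1 + 1, if k.2 then b else b + 1) := ⟨_, rfl⟩
  have hbox : ∀ k, 0 ≤ a k ∧ a k + 1 ≤ X := fun k => by
    have := hg.left (e k)
    have := hg.right _ (hI _ (he k))
    have := hal k
    have := har k
    omega
  have hpb : ∀ k, p k ∈ rect 0 X 0 Y := fun k => by
    have := hbox k.1
    rcases k with ⟨k, _ | _⟩ <;> simp [hp, mem_rect] <;> simp only at this <;> omega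
  have hwb : ∀ k, w k ∈ rect 0 X 0 Y := fun k => by
    have := hbox k.1
    rcases k with ⟨k, _ | _⟩ <;> simp [hw, mem_rect] <;> simp only at this <;> omega
  have hadj : ∀ k, G.Adj (ψ (p k)) (ψ (w k)) := by
    rintro ⟨k, _ | _⟩
    · simpa [hp, hw] using hasc k
    · simpa [hp, hw] using hdesc k
  have hne : ∀ k k', k ≠ k' → p k ≠ p k' ∧ p k ≠ w k' ∧ w k ≠ p k' ∧ w k ≠ w k' := by
    rintro ⟨k, x⟩ ⟨k', x'⟩ hk
    by_cases h : k = k'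
    · subst h
      cases x <;> cases x' <;> simp_all
    · have h1 := hg.le_of_ne (hmono.injective.of_comp.ne h)
      have h2 := hal k
      have h3 := hal k'
      have h4 := har k
      have h5 := har k'
      simp only [hp, hw, ne_eq, Prod.mk.injEq]
      omega
  have hsys : JumpSystem G X Y ψ p w fun k => {ψ (p k), ψ (w k)} := by
    refine ⟨fun k => .inl rfl, fun k => .inr rfl, fun k => connIn_pair (hadj k), ?_, ?_⟩
    · rintro k z hz (h | h)
      · exact .inl (hψ.inj hz (hpb k) h)
      · exact .inr (hψ.inj hz (hwb k) h)
    · intro k k' hk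
      obtain ⟨h1, h2, h3, h4⟩ := hne k k' hk
      rw [Set.disjoint_left]
      rintro x (rfl | rfl) (h | h)
      · exact h1 (hψ.inj (hpb k) (hpb k') h)
      · exact h2 (hψ.inj (hpb k) (hwb k') h)
      · exact h3 (hψ.inj (hwb k) (hpb k') h)
      · exact h4 (hψ.inj (hwb k) (hwb k') h)
  have hpw : ∀ k, p k ≠ w k := fun k => by simp [hp, hw]
  obtain ⟨S, hS⟩ := exists_gridModel_of_gaps (H := jumpGrid p w) (grid_le_jumpGrid _ _) hX hg hR
    hℓ hb hbY hks hm (fun k => hI _ (he k)) hmono a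
    (fun k => by
      have := hal k
      have := har k
      omega)
    fun k => by
      have h1 := jumpGrid_adj p w (k, false) (hpw _)
      have h2 := jumpGrid_adj p w (k, true) (hpw _)
      simp only [hp, hw] at h1 h2
      refine .cross ?_ ?_
      · simpa [hp, hw] using h1
      · simpa [hp, hw] using h2
  exact hsys.hasMinor hψ hS

end

/-- If many far apart gaps contain a jump or a crossing, then there is a `K_t` minor. -/
theorem exists_hasMinor_of_gaps (t : ℕ) : ∃ (W : ℕ) (ℓ Y β : ℤ), 0 < ℓ ∧ 5 ≤ β ∧ β + 5 ≤ Y ∧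
    ∀ {V : Type} (G : SimpleGraph V) (ψ ψ' : ℤ × ℤ → V) (D : ℤ → ℤ → Bool) (X : ℤ) (l r : ℕ → ℤ),
      0 ≤ X → BoxHom G D X Y ψ → Set.InjOn ψ' (rect 0 X 0 Y) → Gaps ℓ X W l r →
      (∀ i < W, HasJump G ψ ψ' X Y β (l i) (r i) ∨ HasCross G ψ β (l i) (r i)) →
      G.HasMinor (⊤ : SimpleGraph (Fin t)) := by
  obtain ⟨ks, hks, hm⟩ := exists_word t
  obtain ⟨R, hR⟩ : ∃ R : ℤ, (2 * t + 4) * t = R := ⟨_, rfl⟩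
  have hR0 : 0 ≤ R := hR ▸ by positivity
  obtain ⟨β, hβ⟩ : ∃ β : ℤ, β = R + 2 * t + 10 := ⟨_, rfl⟩
  obtain ⟨Y, hY⟩ : ∃ Y : ℤ, Y = β + R + 2 * t + 10 := ⟨_, rfl⟩
  obtain ⟨ℓ, hℓ⟩ : ∃ ℓ : ℤ, ℓ = 8 * t + 2 * R + 20 := ⟨_, rfl⟩
  let K : Finset (ℤ × ℤ × ℤ × ℤ) :=
    Finset.Icc 0 2 ×ˢ Finset.Icc 0 Y ×ˢ Finset.Icc (-Y) Y ×ˢ Finset.Icc (-Y) Y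
  refine ⟨K.card * (3 * (t * t * 2) + ks.length) + 1, ℓ, Y, β, by omega, by omega, by omega, ?_⟩
  generalize hW : K.card * (3 * (t * t * 2) + ks.length) + 1 = W
  intro V G ψ ψ' D X l r hX hψ hψ' hg h
  obtain ⟨⟨τ, b, d, e⟩, hk, I, hI, hcard, hP⟩ := exists_monochromatic K
    (3 * (t * t * 2) + ks.length) (Finset.range W) (by simp [← hW])
    (fun k i => (k.1 = 0 ∧ (β - 2 ≤ k.2.1 ∧ k.2.1 ≤ β + 2) ∧ ∃ x, l i ≤ x ∧ x < r i ∧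
        G.Adj (ψ (x, k.2.1)) (ψ (x + 1, k.2.1 + 1)) ∧
        G.Adj (ψ (x, k.2.1 + 1)) (ψ (x + 1, k.2.1))) ∨
      (k.1 = 1 ∧ (β - 3 ≤ k.2.1 ∧ k.2.1 ≤ β + 4) ∧ ∃ a c J,
        IsJump G ψ ψ' X Y (l i) (r i) (a, k.2.1) (c, k.2.2.1) J ∧ l i - 1 ≤ a ∧ a ≤ r i ∧
        (2 * (t : ℤ) < |c - a| ∨ 2 * (t : ℤ) < |k.2.2.1 - k.2.1|)) ∨
      (k.1 = 2 ∧ (β - 3 ≤ k.2.1 ∧ k.2.1 ≤ β + 4) ∧ |k.2.2.1| ≤ 2 * t ∧ |k.2.2.2| ≤ 2 * t ∧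
        ¬ (|k.2.2.1| ≤ 1 ∧ |k.2.2.2| ≤ 1) ∧ ∃ a J,
        IsJump G ψ ψ' X Y (l i) (r i) (a, k.2.1) (a + k.2.2.1, k.2.1 + k.2.2.2) J ∧
        l i - 1 ≤ a ∧ a ≤ r i))
    (by
      intro i hi
      rcases h i (Finset.mem_range.1 hi) with ⟨⟨a, b⟩, ⟨c, d⟩, J, hJ, hp, hn⟩ |
        ⟨x, y, h1, h2, h3, h4, h5, h6⟩
      · have hw := hJ.right_mem
        simp only [mem_rect] at hp hw
        by_cases hfar : 2 * (t : ℤ) < |c - a| ∨ 2 * (t : ℤ) < |d - b|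
        · refine ⟨(1, b, d, 0), ?_, .inr (.inl ⟨rfl, ⟨hp.2.2.1, hp.2.2.2⟩, a, c, J, hJ, hp.1, hp.2.1,
            hfar⟩)⟩
          simp only [K, Finset.mem_product, Finset.mem_Icc]
          omega
        · rw [not_or, not_lt, not_lt] at hfar
          refine ⟨(2, b, c - a, d - b), ?_, .inr (.inr ⟨rfl, ⟨hp.2.2.1, hp.2.2.2⟩, hfar.1, hfar.2, ?_,
            a, J, ?_, hp.1, hp.2.1⟩)⟩
          · have h1 := abs_le.1 hfar.1
            have h2 := abs_le.1 hfar.2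
            simp only [K, Finset.mem_product, Finset.mem_Icc]
            omega
          · simpa [Near, abs_sub_comm] using hn
          · simpa using hJ
      · refine ⟨(0, y, 0, 0), ?_, .inl ⟨rfl, ⟨h3, h4⟩, x, h1, h2, h5, h6⟩⟩
        simp only [K, Finset.mem_product, Finset.mem_Icc]
        omega)
  have hIW : ∀ i ∈ I, i < W := fun i hi => Finset.mem_range.1 (hI hi)
  simp only at hP
  rcases I.eq_empty_or_nonempty with rfl | ⟨i₀, hi₀⟩
  · have h1 : ks.length ≤ (∅ : Finset ℕ).card := by omega
    exact hasMinor_of_cross (b := β) hψ hX hg hR hℓ.ge (by omega) (by omega) (by omega) hks hm hIW h1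
      (by simp)
  rcases hP i₀ hi₀ with ⟨hτ, hb, -⟩ | ⟨hτ, hb, -⟩ | ⟨hτ, hb, hd, he, hde, -⟩
  · refine hasMinor_of_cross (b := b) hψ hX hg hR hℓ.ge (by omega) (by omega) (by omega) hks hm hIW
      (by omega) fun i hi => ?_
    rcases hP i hi with h | h | h
    · exact h.2.2
    · exact absurd (hτ.symm.trans h.1) (by simp)
    · exact absurd (hτ.symm.trans h.1) (by simp)
  · refine hasMinor_of_far (b := b) (d := d) hψ hψ' hg (by omega) hIW (by omega) (by omega) (by omega)
      fun i hi => ?_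
    rcases hP i hi with h | h | h
    · exact absurd (hτ.symm.trans h.1) (by simp)
    · exact h.2.2
    · exact absurd (hτ.symm.trans h.1) (by simp)
  · refine hasMinor_of_short (b := b) (dx := d) (dy := e) hψ hψ' hX hg hR hℓ.ge (by omega) (by omega)
      hks hm hIW (by omega) hd he hde fun i hi => ?_
    rcases hP i hi with h | h | h
    · exact absurd (hτ.symm.trans h.1) (by simp)
    · exact absurd (hτ.symm.trans h.1) (by simp)
    · exact h.2.2.2.2.2

/-- The diagonal pattern whose row `β` encodes the set `u` periodically with period `ℓ`. -/
def bitPattern (ℓ β : ℤ) (u : Finset ℤ) (x y : ℤ) : Bool :=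
  if y = β then decide (x % ℓ ∈ u) else decide (β < y)

lemma bitRow_bitPattern (ℓ β : ℤ) (u : Finset ℤ) : BitRow β (bitPattern ℓ β u) := by
  constructor <;> intro x y h <;> simp [bitPattern, h.ne, h.ne', h, h.le]

/-- Column by column enumeration of `ℕ × {0, …, R - 1}`. -/
def gridPos (R i : ℕ) : ℤ × ℤ := ((i / R : ℕ), (i % R : ℕ))

lemma gridPos_injective (R : ℕ) : Function.Injective (gridPos R) := by
  intro i j h
  simp only [gridPos, Prod.mk.injEq, Nat.cast_inj] at h
  rw [← Nat.div_add_mod i R, ← Nat.div_add_mod j R, h.1, h.2]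

lemma exists_boxHom {V : Type*} {U : SimpleGraph V} {n R : ℕ} {X Y : ℤ} (D : ℤ → ℤ → Bool)
    (hn : 0 < n) (hY : (R : ℤ) = Y + 1) (hXn : (X + 1) * R ≤ n)
    (h : ∀ H : SimpleGraph (Fin n), IsPlanarW H → ContainsSub U H) :
    ∃ ψ, BoxHom U D X Y ψ := by
  have : ∀ p : ℤ × ℤ, ∃ i : Fin n, p ∈ rect 0 X 0 Y → gridPos R i = p := by
    rintro ⟨x, y⟩
    by_cases hp : (x, y) ∈ rect 0 X 0 Y
    · simp only [mem_rect] at hp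
      obtain ⟨x, rfl⟩ := Int.eq_ofNat_of_zero_le hp.1
      obtain ⟨y, rfl⟩ := Int.eq_ofNat_of_zero_le hp.2.2.1
      have hy : y < R := by omega
      have hlt : y + R * x < n := by
        zify
        nlinarith
      refine ⟨⟨y + R * x, hlt⟩, fun _ => ?_⟩
      simp [gridPos, Nat.add_mul_div_left _ _ (show 0 < R by omega), Nat.div_eq_of_lt hy,
        Nat.mod_eq_of_lt hy]
    · exact ⟨⟨0, hn⟩, fun h => absurd h hp⟩
  choose g hg using this
  obtain ⟨f, hf, hfa⟩ := h ((triGrid D).comap fun i => gridPos R i)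
    (isPlanarW_comap_triGrid D _ ((gridPos_injective R).comp Fin.val_injective))
  refine ⟨fun p => f (g p), fun p hp q hq hpq => ?_, fun p hp q hq hpq => hfa _ _ ?_⟩
  · rw [← hg p hp, ← hg q hq, hf hpq]
  · rwa [comap_adj, hg p hp, hg q hq]

/-- An embedded grid is almost determined by its restriction to few columns. -/
lemma two_pow_le_of_universal {t N n W ℓ R : ℕ} {U : SimpleGraph (Fin N)} {ℓ₀ Y β : ℤ}
    (hβ : 5 ≤ β) (hβY : β + 5 ≤ Y)
    (hmin : ∀ {V : Type} (G : SimpleGraph V) (ψ ψ' : ℤ × ℤ → V) (D : ℤ → ℤ → Bool) (X : ℤ)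
      (l r : ℕ → ℤ), 0 ≤ X → BoxHom G D X Y ψ → Set.InjOn ψ' (rect 0 X 0 Y) → Gaps ℓ₀ X W l r →
      (∀ i < W, HasJump G ψ ψ' X Y β (l i) (r i) ∨ HasCross G ψ β (l i) (r i)) →
      G.HasMinor (⊤ : SimpleGraph (Fin t)))
    (hU : ¬ U.HasMinor (⊤ : SimpleGraph (Fin t)))
    (h : ∀ H : SimpleGraph (Fin n), IsPlanarW H → ContainsSub U H)
    (hY : (R : ℤ) = Y + 1) (hℓ : 2 ≤ ℓ) (hℓ₀ : ℓ₀ ≤ ℓ) (hn : (2 * W + 4) * R * ℓ ≤ n) :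
    2 ^ (ℓ - 1) ≤ N ^ ((2 * W + 1) * 2 * R) := by
  by_contra hlt
  have hℓ' : (2 : ℤ) ≤ ℓ := by exact_mod_cast hℓ
  obtain ⟨X, hX⟩ : ∃ X : ℤ, X = (2 * W + 2) * ℓ + 1 := ⟨_, rfl⟩
  have hX0 : 0 ≤ X := hX ▸ by positivity
  have hR : 0 < R := by omega
  have hXn : (X + 1) * R ≤ n := by
    zify at hn
    have h1 : X + 1 ≤ (2 * W + 4) * ℓ := by linarith
    have h2 := mul_le_mul_of_nonneg_right h1 (show (0 : ℤ) ≤ R by positivity)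
    linarith
  have hn0 : 0 < n := lt_of_lt_of_le (by positivity) hn
  choose ψ hψ using fun u => exists_boxHom (bitPattern ℓ β u) hn0 hY hXn h
  obtain ⟨u, hu, u', hu', hne, heq⟩ := Finset.exists_ne_map_eq_of_card_lt_of_maps_to
    (s := (Finset.Ico (1 : ℤ) ℓ).powerset)
    (t := (Finset.univ : Finset (Fin (2 * W + 1) × Bool × Fin R → Fin N)))
    (f := fun u k => ψ u ((k.1 : ℕ) * ℓ + if k.2.1 then 1 else 0, (k.2.2 : ℕ)))
    (by
      have h1 : ((ℓ : ℤ) - 1).toNat = ℓ - 1 := by omega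
      rw [Finset.card_powerset, Int.card_Ico, h1]
      simpa [mul_assoc] using hlt)
    (fun _ _ => Finset.mem_univ _)
  have hagree : ∀ (j : ℕ) (s : Bool) (y : ℤ), j < 2 * W + 1 → 0 ≤ y → y ≤ Y →
      ψ u' (j * ℓ + if s then 1 else 0, y) = ψ u (j * ℓ + if s then 1 else 0, y) := by
    intro j s y hj hy hyY
    obtain ⟨y, rfl⟩ := Int.eq_ofNat_of_zero_le hy
    exact (congrFun heq (⟨j, hj⟩, s, ⟨y, by omega⟩)).symm
  obtain ⟨k, hk, hkne⟩ : ∃ k ∈ Finset.Ico (1 : ℤ) ℓ, ¬ (k ∈ u ↔ k ∈ u') := by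
    by_contra! hall
    rw [Finset.mem_powerset] at hu hu'
    exact hne (Finset.ext fun k => ⟨fun hk => (hall k (hu hk)).1 hk, fun hk => (hall k (hu' hk)).2 hk⟩)
  rw [Finset.mem_Ico] at hk
  refine hU (hmin U (ψ u) (ψ u') _ X (fun i => (2 * i + 1) * ℓ + 1) (fun i => (2 * i + 2) * ℓ) hX0
    (hψ u) (hψ u').inj ⟨fun i => ?_, fun i j hij => ?_, fun i hi => ?_⟩
    fun i hi => ?_)
  · have : (0 : ℤ) ≤ i * ℓ := by positivity
    linarith
  · have h1 : ((i : ℤ) + 1) * ℓ ≤ j * ℓ :=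
      mul_le_mul_of_nonneg_right (by exact_mod_cast hij) (by positivity)
    linarith
  · have h1 : ((i : ℤ) + 1) * ℓ ≤ W * ℓ :=
      mul_le_mul_of_nonneg_right (by exact_mod_cast hi) (by positivity)
    linarith
  · have h1 : ((i : ℤ) + 1) * ℓ ≤ W * ℓ :=
      mul_le_mul_of_nonneg_right (by exact_mod_cast hi) (by positivity)
    have h2 : (0 : ℤ) ≤ i * ℓ := by positivity
    refine GapPair.hasJump_or_hasCross (c := (2 * i + 1) * ℓ + k)
      ⟨hψ u, hψ u', bitRow_bitPattern _ _ _, by linarith, by linarith, hβ, hβY, ?_⟩ (by linarith) (by linarith) ?_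
    · rintro x y (rfl | rfl | rfl) hy hyY
      · simpa using hagree (2 * i + 1) false y (by omega) hy hyY
      · simpa using hagree (2 * i + 1) true y (by omega) hy hyY
      · simpa using hagree (2 * i + 2) false y (by omega) hy hyY
    · have h3 : ((2 * i + 1) * ℓ + k) % ℓ = k := by
        rw [add_comm, Int.add_mul_emod_self_right, Int.emod_eq_of_lt (by omega) hk.2]
      simpa [bitPattern, h3] using hkne

/-- For every `t ≥ 5` there is a constant `C_t > 0` such that for every
`n ≥ 2`, every `K_t`-minor-free graph containing every `n`-vertex planar graph as a
subgraph has at least `2^(C_t · n)` vertices. -/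
theorem statement1 (t : ℕ) (ht : 5 ≤ t) :
    ∃ C : ℝ, 0 < C ∧
      ∀ n : ℕ, 2 ≤ n →
        ∀ (N : ℕ) (U : SimpleGraph (Fin N)),
          ¬ U.HasMinor (⊤ : SimpleGraph (Fin t)) →
          (∀ H : SimpleGraph (Fin n), IsPlanarW H → ContainsSub U H) →
          (2 : ℝ) ^ (C * (n : ℝ)) ≤ (N : ℝ) := by
  obtain ⟨W, ℓ₀, Y, β, hℓ₀, hβ, hβY, hmin⟩ := exists_hasMinor_of_gaps t
  obtain ⟨R, hR⟩ := Int.eq_ofNat_of_zero_le (show 0 ≤ Y + 1 by omega)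
  have hR0 : 0 < R := by omega
  obtain ⟨Q, hQ⟩ : ∃ Q, (2 * W + 4) * R = Q := ⟨_, rfl⟩
  obtain ⟨K, hK⟩ : ∃ K, (2 * W + 1) * 2 * R = K := ⟨_, rfl⟩
  obtain ⟨m, hm⟩ : ∃ m, ℓ₀.toNat + 3 = m := ⟨_, rfl⟩
  have hQ0 : 0 < Q := hQ ▸ by positivity
  have hK0 : 0 < K := hK ▸ by positivity
  have hm0 : 0 < m := by omega
  refine ⟨1 / (2 * Q * K * m), by positivity, fun n hn N U hU h => ?_⟩
  by_cases hnQ : n < m * Q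
  · have hnN : n ≤ N := by
      obtain ⟨f, hf, -⟩ := h _ (isPlanarW_comap_triGrid (fun _ _ => true) (fun i : Fin n => gridPos 1 i)
        ((gridPos_injective 1).comp Fin.val_injective))
      simpa using Fintype.card_le_of_injective f hf
    have h1 : (n : ℝ) ≤ 2 * Q * K * m := by
      have : n ≤ 2 * Q * K * m := by nlinarith [Nat.mul_le_mul_left (m * Q) hK0]
      exact_mod_cast this
    calc (2 : ℝ) ^ (1 / (2 * Q * K * m) * (n : ℝ)) ≤ (2 : ℝ) ^ (1 : ℝ) := by
          refine Real.rpow_le_rpow_of_exponent_le one_le_two ?_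
          rw [one_div_mul_eq_div]
          exact div_le_one_of_le₀ h1 (by positivity)
      _ ≤ N := by
          rw [Real.rpow_one]
          exact_mod_cast hn.trans hnN
  · rw [not_lt, ← Nat.le_div_iff_mul_le hQ0] at hnQ
    obtain ⟨ℓ, hℓ⟩ : ∃ ℓ, n / Q = ℓ := ⟨_, rfl⟩
    have hlow : Q * ℓ ≤ n := hℓ ▸ Nat.mul_div_le n Q
    have hup : n < Q * (ℓ + 1) := hℓ ▸ Nat.lt_mul_div_succ n hQ0
    have hpow := two_pow_le_of_universal (ℓ := ℓ) hβ hβY hmin hU h hR.symm (by omega) (by omega)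
      (by rwa [hQ])
    rw [hK] at hpow
    refine le_of_pow_le_pow_left₀ hK0.ne' (by positivity) ?_
    rw [← Real.rpow_natCast, ← Real.rpow_mul two_pos.le]
    calc (2 : ℝ) ^ (1 / (2 * Q * K * m) * n * K : ℝ) ≤ (2 : ℝ) ^ ((ℓ - 1 : ℕ) : ℝ) := by
          refine Real.rpow_le_rpow_of_exponent_le one_le_two ?_
          have h1 : n * K ≤ (ℓ - 1) * (2 * Q * K * m) := by
            obtain ⟨k, rfl⟩ : ∃ k, ℓ = k + 2 := ⟨ℓ - 2, by omega⟩
            have hk : 1 ≤ k := by omega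
            have h2 : n ≤ (k + 1) * (2 * Q) := by nlinarith
            calc n * K ≤ (k + 1) * (2 * Q) * K * m :=
                  (Nat.mul_le_mul_right K h2).trans (Nat.le_mul_of_pos_right _ hm0)
              _ = _ := by simp; ring
          rw [one_div_mul_eq_div, div_mul_eq_mul_div, div_le_iff₀ (by positivity)]
          exact_mod_cast h1
      _ ≤ (N : ℝ) ^ K := by
          rw [Real.rpow_natCast]
          exact_mod_cast hpow
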